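/- arXiv:2411.00798 — 2 statements merged into one kernel-verified Lean document; each statement's English description precedes it below -/
import Mathlib

section
/- The second-order differential operator D_L is W_L-symmetric: for all P, Q ∈ Mat_N(ℂ[x]), ∫_0^∞ (P·D_L)(x) W_L(x) Q(x)^* dx = ∫_0^∞ P(x) W_L(x) ((Q·D_L)(x))^* dx. -/
open Polynomial MeasureTheory Matrix

noncomputable section

abbrev Mat (N : ℕ) := Matrix (Fin N) (Fin N) ℂ

/-- The matrix unit with a `1` in the (1-indexed) entry `(s, t)` and `0` elsewhere. -/
def EU (N : ℕ) (s t : ℕ) : Mat N :=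
  Matrix.of fun p q => if (p : ℕ) + 1 = s ∧ (q : ℕ) + 1 = t then 1 else 0

/-- Evaluation of a matrix polynomial at a real point. -/
def mval {N : ℕ} (P : Polynomial (Mat N)) (x : ℝ) : Mat N :=
  Polynomial.eval ((x : ℂ) • (1 : Mat N)) P

/-- The nilpotent matrix `A = Σ a_{2j-1} E_{2j-1,2j} + Σ a_{2j} E_{2j+1,2j}`. -/
def Amat (N : ℕ) (a : ℕ → ℝ) : Mat N :=
  (∑ j ∈ Finset.Icc 1 (N / 2), (a (2 * j - 1) : ℂ) • EU N (2 * j - 1) (2 * j)) +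
  (∑ j ∈ Finset.Icc 1 ((N - 1) / 2), (a (2 * j) : ℂ) • EU N (2 * j + 1) (2 * j))

/-- `K = Σ_{j=1}^{⌊N/2⌋} E_{2j,2j}`. -/
def Kmat (N : ℕ) : Mat N := ∑ j ∈ Finset.Icc 1 (N / 2), EU N (2 * j) (2 * j)

/-- `T(x) = I + x A`. -/
def Tmat (N : ℕ) (a : ℕ → ℝ) (x : ℝ) : Mat N := 1 + (x : ℂ) • Amat N a

/-- The diagonal Laguerre weight `diag(e^{-x}x^{α₁}, …, e^{-x}x^{α_N})` (1-indexed `α`). -/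
def laguerreDiag (N : ℕ) (α : ℕ → ℝ) (x : ℝ) : Mat N :=
  Matrix.diagonal fun i => ((Real.exp (-x) * x ^ α ((i : ℕ) + 1) : ℝ) : ℂ)

/-- The Laguerre-type weight `W_L(x) = T(x) · diag(…) · T(x)^*`. -/
def WL (N : ℕ) (a α : ℕ → ℝ) (x : ℝ) : Mat N :=
  Tmat N a x * laguerreDiag N α x * (Tmat N a x)ᴴ

/-- `B = diag(α₁+1, …, α_N+1)`. -/
def BL (N : ℕ) (α : ℕ → ℝ) : Mat N :=
  Matrix.diagonal fun i => ((α ((i : ℕ) + 1) + 1 : ℝ) : ℂ)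

/-- The right action of the differential operator `D_L`:
`P·D_L = xP'' + P'·(B − xI + 2xA + x(AB − BA)) + P·(AB + K)`. -/
def DL {N : ℕ} (a α : ℕ → ℝ) (P : Polynomial (Mat N)) : Polynomial (Mat N) :=
  Polynomial.X * derivative (derivative P)
    + derivative P * (Polynomial.C (BL N α)
        + Polynomial.X *
            Polynomial.C (2 • Amat N a + Amat N a * BL N α - BL N α * Amat N a - 1))
    + P * Polynomial.C (Amat N a * BL N α + Kmat N)

lemma mval_add {N : ℕ} (P Q : Polynomial (Mat N)) (x : ℝ) :
    mval (P + Q) x = mval P x + mval Q x := eval_add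

lemma mval_mul {N : ℕ} (P Q : Polynomial (Mat N)) (x : ℝ) :
    mval (P * Q) x = mval P x * mval Q x := by
  unfold mval
  exact eval₂_mul_noncomm (RingHom.id _) _ fun k => by
    simp [Commute, SemiconjBy]

lemma mval_C {N : ℕ} (M : Mat N) (x : ℝ) : mval (C M) x = M := eval_C

lemma mval_X {N : ℕ} (x : ℝ) : mval (X : Polynomial (Mat N)) x = (x : ℂ) • 1 := eval_X

/-- The scalar polynomial formed by the `(s, i)` entries of a matrix polynomial. -/
def entryPoly {N : ℕ} (P : Polynomial (Mat N)) (s i : Fin N) : ℂ[X] :=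
  matPolyEquiv.symm P s i

lemma eval_entryPoly {N : ℕ} (P : Polynomial (Mat N)) (s i : Fin N) (x : ℝ) :
    (entryPoly P s i).eval (x : ℂ) = mval P x s i := by
  have h := matPolyEquiv_eval (matPolyEquiv.symm P) (x : ℂ) s i
  rw [AlgEquiv.apply_symm_apply] at h
  rw [entryPoly, ← h, mval, Matrix.scalar_apply, Matrix.smul_one_eq_diagonal]

lemma derivative_entryPoly {N : ℕ} (P : Polynomial (Mat N)) (s i : Fin N) :
    derivative (entryPoly P s i) = entryPoly (derivative P) s i := by
  ext k
  have h (Q : Polynomial (Mat N)) (k : ℕ) : (entryPoly Q s i).coeff k = Q.coeff k s i := by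
    rw [entryPoly, ← matPolyEquiv_coeff_apply, AlgEquiv.apply_symm_apply]
  rw [coeff_derivative, h, h, coeff_derivative]
  have : ((k : Mat N) + 1) = ((k + 1 : ℂ)) • (1 : Mat N) := by
    rw [add_smul, one_smul, Nat.cast_smul_eq_nsmul, nsmul_one]
  rw [this, Matrix.mul_smul, mul_one, Matrix.smul_apply, smul_eq_mul, mul_comm]

/-- The Laguerre weight integrates every polynomial. -/
lemma integrableOn_laguerre {α : ℝ} (hα : -1 < α) (p : ℂ[X]) :
    IntegrableOn (fun x : ℝ => p.eval (x : ℂ) * ((Real.exp (-x) * x ^ α : ℝ) : ℂ))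
      (Set.Ioi 0) := by
  induction p using Polynomial.induction_on' with
  | add p q hp hq =>
    simp only [eval_add, add_mul]
    exact hp.add hq
  | monomial n c =>
    have h : IntegrableOn (fun x : ℝ =>
        c * ((Real.exp (-x) * x ^ (α + n + 1 - 1) : ℝ) : ℂ)) (Set.Ioi 0) :=
      (Real.GammaIntegral_convergent (s := α + n + 1)
      (by have : (0 : ℝ) ≤ n := n.cast_nonneg
          linarith)).ofReal (𝕜 := ℂ) |>.const_mul c
    refine IntegrableOn.congr_fun h (fun x hx => ?_) measurableSet_Ioi
    have hx : 0 < x := hx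
    simp only [eval_monomial]
    rw [show α + n + 1 - 1 = α + n by ring, Real.rpow_add hx, Real.rpow_natCast]
    push_cast
    ring

lemma integral_monomial_laguerre {α : ℝ} (hα : -1 < α) (n : ℕ) (c : ℂ) :
    ∫ x in Set.Ioi (0 : ℝ), (monomial n c).eval (x : ℂ) * ((Real.exp (-x) * x ^ α : ℝ) : ℂ)
      = c * (Real.Gamma (α + n + 1) : ℂ) := by
  have hn : (0 : ℝ) ≤ n := n.cast_nonneg
  rw [Real.Gamma_eq_integral (by linarith), ← integral_complex_ofReal, ← integral_const_mul]
  refine setIntegral_congr_fun measurableSet_Ioi fun x hx => ?_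
  have hx : 0 < x := hx
  simp only [eval_monomial]
  rw [show α + n + 1 - 1 = α + n by ring, Real.rpow_add hx, Real.rpow_natCast]
  push_cast
  ring

/-- Integration by parts against the Laguerre weight. -/
lemma integral_laguerre_pearson {α : ℝ} (hα : -1 < α) (p : ℂ[X]) :
    ∫ x in Set.Ioi (0 : ℝ), (X * derivative p + (C ((α : ℂ) + 1) - X) * p).eval (x : ℂ)
      * ((Real.exp (-x) * x ^ α : ℝ) : ℂ) = 0 := by
  induction p using Polynomial.induction_on' with
  | add p q hp hq =>
    have h := integral_add (integrableOn_laguerre hα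
      (X * derivative p + (C ((α : ℂ) + 1) - X) * p))
      (integrableOn_laguerre hα (X * derivative q + (C ((α : ℂ) + 1) - X) * q))
    rw [hp, hq, add_zero] at h
    rw [← h]
    congr 1
    ext x
    simp only [derivative_add, eval_add, eval_mul, eval_X, eval_sub, eval_C]
    ring
  | monomial n c =>
    have h : X * derivative (monomial n c) + (C ((α : ℂ) + 1) - X) * monomial n c
        = monomial n ((α + n + 1) * c) + monomial (n + 1) (-c) := by
      rcases n with _ | n
      · simp [sub_mul, ← C_mul_X_pow_eq_monomial]
        ring
      · simp [sub_mul, ← C_mul_X_pow_eq_monomial]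
        ring
    have hn : (0 : ℝ) ≤ n := n.cast_nonneg
    simp only [h, eval_add, add_mul (eval _ _)]
    rw [integral_add (integrableOn_laguerre hα _) (integrableOn_laguerre hα _),
      integral_monomial_laguerre hα, integral_monomial_laguerre hα]
    have hG := Real.Gamma_add_one (s := α + n + 1) (by linarith)
    rw [show α + ((n + 1 : ℕ) : ℝ) + 1 = α + n + 1 + 1 by push_cast; ring, hG]
    push_cast
    ring

/-- The scalar Laguerre operator `x r'' + (α + 1 - x) r' + k r`. -/
def laguerreOp (α : ℝ) (k : ℂ) (r : ℂ[X]) : ℂ[X] :=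
  X * derivative (derivative r) + (C ((α : ℂ) + 1) - X) * derivative r + C k * r

lemma integral_laguerreOp_mul {α : ℝ} (hα : -1 < α) (k : ℂ) (r s : ℂ[X]) :
    ∫ x in Set.Ioi (0 : ℝ), (laguerreOp α k r * s).eval (x : ℂ)
        * ((Real.exp (-x) * x ^ α : ℝ) : ℂ)
      = ∫ x in Set.Ioi (0 : ℝ), (r * laguerreOp α k s).eval (x : ℂ)
        * ((Real.exp (-x) * x ^ α : ℝ) : ℂ) := by
  rw [← sub_eq_zero, ← integral_sub (integrableOn_laguerre hα _) (integrableOn_laguerre hα _),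
    ← integral_laguerre_pearson hα (derivative r * s - r * derivative s)]
  congr 1
  ext x
  rw [← sub_mul, ← eval_sub]
  congr 2
  simp only [laguerreOp, derivative_sub, derivative_mul]
  ring

lemma star_eval_ofReal (p : ℂ[X]) (x : ℝ) :
    star (p.eval (x : ℂ)) = (p.map (starRingEnd ℂ)).eval (x : ℂ) := by
  have h := Polynomial.eval₂_at_apply (p := p) (starRingEnd ℂ) (x : ℂ)
  rw [Complex.conj_ofReal] at h
  rw [eval_map, h]
  rfl

lemma map_laguerreOp (α : ℝ) (k : ℝ) (r : ℂ[X]) :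
    (laguerreOp α k r).map (starRingEnd ℂ) = laguerreOp α k (r.map (starRingEnd ℂ)) := by
  simp [laguerreOp, derivative_map]

lemma Amat_apply_eq_zero (N : ℕ) (a : ℕ → ℝ) (p q : Fin N) (h : ¬ (Even (p : ℕ) ∧ Odd (q : ℕ))) :
    Amat N a p q = 0 := by
  simp only [Amat, EU, Matrix.add_apply, Matrix.sum_apply, Matrix.smul_apply, Matrix.of_apply]
  rw [Finset.sum_eq_zero, Finset.sum_eq_zero, add_zero] <;>
  · intro j hj
    rw [Finset.mem_Icc] at hj
    rw [if_neg, smul_zero]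
    rintro ⟨h1, h2⟩
    exact h ⟨by grind, by grind⟩

lemma Kmat_eq_diagonal (N : ℕ) :
    Kmat N = Matrix.diagonal fun i : Fin N => (((if Odd (i : ℕ) then 1 else 0 : ℝ)) : ℂ) := by
  ext p q
  simp only [Kmat, EU, Matrix.sum_apply, Matrix.of_apply, Matrix.diagonal_apply]
  by_cases hp : p = q ∧ Odd (p : ℕ)
  · obtain ⟨rfl, j, hj⟩ := hp
    rw [Finset.sum_eq_single (j + 1)]
    · rw [if_pos (by omega), if_pos rfl, if_pos ⟨j, hj⟩, Complex.ofReal_one]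
    · intro b _ hb
      rw [if_neg (by omega)]
    · intro hb
      exact absurd (Finset.mem_Icc.2 (by have := p.2; omega)) hb
  · rw [Finset.sum_eq_zero]
    · split_ifs with h1 h2
      · exact absurd ⟨h1, h2⟩ hp
      · simp
      · rfl
    · intro j hj
      rw [Finset.mem_Icc] at hj
      rw [if_neg]
      rintro ⟨h1, h2⟩
      exact hp ⟨Fin.ext (by omega), by grind⟩

lemma Amat_mul_diagonal_mul_Amat (N : ℕ) (a : ℕ → ℝ) (d : Fin N → ℂ) :
    Amat N a * Matrix.diagonal d * Amat N a = 0 := by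
  ext p q
  rw [Matrix.mul_apply]
  refine Finset.sum_eq_zero fun j _ => ?_
  rw [Matrix.mul_diagonal]
  rcases Nat.even_or_odd (j : ℕ) with hj | hj
  · rw [Amat_apply_eq_zero N a p j (by grind), zero_mul, zero_mul]
  · rw [Amat_apply_eq_zero N a j q (by grind), mul_zero]

lemma Amat_mul_Amat (N : ℕ) (a : ℕ → ℝ) : Amat N a * Amat N a = 0 := by
  simpa using Amat_mul_diagonal_mul_Amat N a 1

lemma Kmat_mul_Amat (N : ℕ) (a : ℕ → ℝ) : Kmat N * Amat N a = 0 := by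
  ext p q
  rw [Kmat_eq_diagonal, Matrix.diagonal_mul, Matrix.zero_apply]
  split_ifs with hp
  · rw [Amat_apply_eq_zero N a p q (by grind), mul_zero]
  · simp

lemma Amat_mul_Kmat (N : ℕ) (a : ℕ → ℝ) : Amat N a * Kmat N = Amat N a := by
  ext p q
  rw [Kmat_eq_diagonal, Matrix.mul_diagonal]
  split_ifs with hq
  · simp
  · rw [Amat_apply_eq_zero N a p q (by grind), zero_mul]

/-- The matrix polynomial `T(x) = I + x A`. -/
def Tpoly (N : ℕ) (a : ℕ → ℝ) : Polynomial (Mat N) := 1 + X * C (Amat N a)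

lemma mval_Tpoly (N : ℕ) (a : ℕ → ℝ) (x : ℝ) : mval (Tpoly N a) x = Tmat N a x := by
  rw [Tpoly, ← C_1, mval_add, mval_mul, mval_C, mval_C, mval_X, Tmat, smul_mul_assoc, one_mul]

/-- Conjugation by `T` turns `D_L` into a diagonal operator. -/
lemma mval_DL_mul_Tmat {N : ℕ} (a α : ℕ → ℝ) (P : Polynomial (Mat N)) (x : ℝ) :
    mval (DL a α P) x * Tmat N a x
      = (x : ℂ) • mval (derivative (derivative (P * Tpoly N a))) x
        + mval (derivative (P * Tpoly N a)) x * (BL N α - (x : ℂ) • 1)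
        + mval (P * Tpoly N a) x * Kmat N := by
  have hT : derivative (Tpoly N a) = C (Amat N a) := by simp [Tpoly]
  have h1 : derivative (P * Tpoly N a) = derivative P * Tpoly N a + P * C (Amat N a) := by
    rw [derivative_mul, hT]
  have h2 : derivative (derivative (P * Tpoly N a))
      = derivative (derivative P) * Tpoly N a + derivative P * C (Amat N a)
        + derivative P * C (Amat N a) := by
    rw [h1, derivative_add, derivative_mul, hT, derivative_mul, derivative_C, mul_zero, add_zero]
  rw [h2, h1]
  simp only [DL, mval_add, mval_mul, mval_C, mval_X, mval_Tpoly, Tmat]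
  have hAA := Amat_mul_Amat N a
  have hABA : Amat N a * (BL N α * Amat N a) = 0 := by
    rw [← mul_assoc]
    exact Amat_mul_diagonal_mul_Amat N a _
  have hKA := Kmat_mul_Amat N a
  have hAK := Amat_mul_Kmat N a
  generalize Amat N a = A at *
  generalize BL N α = B at *
  generalize Kmat N = K at *
  generalize mval P x = P0
  generalize mval (derivative P) x = P1
  generalize mval (derivative (derivative P)) x = P2
  simp only [mul_add, add_mul, mul_sub, sub_mul, smul_mul_assoc, mul_smul_comm, one_mul, mul_one,
    mul_assoc, hAA, hABA, hKA, hAK, mul_zero, smul_zero, add_zero, sub_zero, smul_add, smul_sub]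
  module

lemma mval_DL_mul_Tmat_apply {N : ℕ} (a α : ℕ → ℝ) (P : Polynomial (Mat N)) (x : ℝ)
    (s i : Fin N) :
    (mval (DL a α P) x * Tmat N a x) s i
      = (laguerreOp (α (i + 1)) ((if Odd (i : ℕ) then 1 else 0 : ℝ) : ℂ)
          (entryPoly (P * Tpoly N a) s i)).eval (x : ℂ) := by
  rw [mval_DL_mul_Tmat, Kmat_eq_diagonal, BL, Matrix.smul_one_eq_diagonal, Matrix.diagonal_sub]
  simp only [Matrix.add_apply, Matrix.smul_apply, Matrix.mul_diagonal, laguerreOp, eval_add,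
    eval_mul, eval_X, eval_C, eval_sub, derivative_entryPoly, eval_entryPoly, smul_eq_mul]
  push_cast
  ring

lemma mul_WL_mul_conjTranspose_apply {N : ℕ} (a α : ℕ → ℝ) (M L : Mat N) (x : ℝ) (s t : Fin N) :
    (M * WL N a α x * Lᴴ) s t
      = ∑ i, (M * Tmat N a x) s i * star ((L * Tmat N a x) t i)
          * ((Real.exp (-x) * x ^ α ((i : ℕ) + 1) : ℝ) : ℂ) := by
  have h : M * WL N a α x * Lᴴ
      = M * Tmat N a x * laguerreDiag N α x * (L * Tmat N a x)ᴴ := by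
    rw [WL, Matrix.conjTranspose_mul]
    simp only [mul_assoc]
  rw [h, laguerreDiag, Matrix.mul_apply]
  refine Finset.sum_congr rfl fun i _ => ?_
  rw [Matrix.mul_diagonal, Matrix.conjTranspose_apply]
  ring

/-- the second-order differential operator `D_L` is `W_L`-symmetric. -/
theorem stmt4 (N : ℕ) (hN : 2 ≤ N) (a : ℕ → ℝ)
    (ha : ∀ j, 1 ≤ j → j ≤ N - 1 → a j ≠ 0)
    (α : ℕ → ℝ)
    (hα : ∀ j, 1 ≤ j → j ≤ N → -1 < α j)
    (hαint : ∀ i j, 1 ≤ i → i ≤ N → 1 ≤ j → j ≤ N → i ≠ j →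
      ¬ ∃ k : ℤ, α i - α j = (k : ℝ)) :
    ∀ P Q : Polynomial (Mat N), ∀ s t : Fin N,
      ∫ x in Set.Ioi (0 : ℝ), (mval (DL a α P) x * WL N a α x * (mval Q x)ᴴ) s t
        = ∫ x in Set.Ioi (0 : ℝ), (mval P x * WL N a α x * (mval (DL a α Q) x)ᴴ) s t := by
  intro P Q s t
  have hα' (i : Fin N) : -1 < α ((i : ℕ) + 1) := hα _ (by omega) (by omega)
  have hT (P : Polynomial (Mat N)) (x : ℝ) (s i : Fin N) :
      (mval P x * Tmat N a x) s i = (entryPoly (P * Tpoly N a) s i).eval (x : ℂ) := by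
    rw [eval_entryPoly, mval_mul, mval_Tpoly]
  simp only [mul_WL_mul_conjTranspose_apply, mval_DL_mul_Tmat_apply]
  simp only [hT, star_eval_ofReal, map_laguerreOp, ← eval_mul]
  rw [integral_finsetSum _ fun i _ => integrableOn_laguerre (hα' i) _,
    integral_finsetSum _ fun i _ => integrableOn_laguerre (hα' i) _]
  exact Finset.sum_congr rfl fun i _ => integral_laguerreOp_mul (hα' i) _ _ _
end
end

section
/- Let {P_n}_{n≥0} be a sequence of monic orthogonal polynomials for W_H, and let 𝔇 be a differential operator with matrix polynomial coefficients F_0, …, F_n ∈ Mat_N(ℂ[x]) with F_n ≠ 0, such that for every k ≥ 0 there exists Λ_k ∈ Mat_N(ℂ) with P_k·𝔇 = Λ_k P_k. Then the order n is even and the leading coefficient F_n is a constant scalar matrix: F_n = cI for some c ∈ ℂ. -/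
open Polynomial MeasureTheory Matrix

noncomputable section

/-- The diagonal Hermite weight `diag(e^{-x²+2b₁x}, …, e^{-x²+2b_Nx})` (1-indexed `b`). -/
def hermiteDiag (N : ℕ) (b : ℕ → ℝ) (x : ℝ) : Mat N :=
  Matrix.diagonal fun i => (Real.exp (-x ^ 2 + 2 * b ((i : ℕ) + 1) * x) : ℂ)

/-- The Hermite-type weight `W_H(x) = T(x) · diag(…) · T(x)^*`. -/
def WH (N : ℕ) (a b : ℕ → ℝ) (x : ℝ) : Mat N :=
  Tmat N a x * hermiteDiag N b x * (Tmat N a x)ᴴ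

/-- The right action `P·𝔇 = Σ_{j=0}^n P^{(j)} F_j` of a differential operator with
matrix-polynomial coefficients `F_0, …, F_n`. -/
def applyOp {N : ℕ} (F : ℕ → Polynomial (Mat N)) (n : ℕ) (P : Polynomial (Mat N)) :
    Polynomial (Mat N) :=
  ∑ j ∈ Finset.range (n + 1), (fun Q : Polynomial (Mat N) => derivative Q)^[j] P * F j

/-- The first moment identity characterising the Gaussian weight `e^{-x²+2βx}`. -/
structure IsHermiteFunctional (β : ℂ) (L : ℂ[X] →ₗ[ℂ] ℂ) : Prop where
  deriv : ∀ p, L (derivative p) = 2 * L ((X - C β) * p)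
  one_ne_zero : L 1 ≠ 0

namespace IsHermiteFunctional

variable {β : ℂ} {L : ℂ[X] →ₗ[ℂ] ℂ}

lemma deriv_mul (h : IsHermiteFunctional β L) (p s : ℂ[X]) :
    L (derivative p * s) = L (p * (2 * (X - C β) * s - derivative s)) := by
  have h1 := h.deriv (p * s)
  rw [derivative_mul, map_add] at h1
  have h2 : p * (2 * (X - C β) * s - derivative s) =
      (2 : ℂ) • ((X - C β) * (p * s)) - p * derivative s := by
    rw [smul_eq_C_mul, C_ofNat]; ring
  rw [h2, map_sub, map_smul, smul_eq_mul, ← h1]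
  ring

lemma eq_zero_of_degree_lt (h : IsHermiteFunctional β L) (d : ℕ) :
    ∀ f : ℂ[X], f.degree < d → (∀ g : ℂ[X], g.degree < d → L (f * g) = 0) → f = 0 := by
  induction d with
  | zero => intro f hf _; simpa using hf
  | succ d ih =>
    intro f hf hg
    have hder : ∀ (q : ℂ[X]), q.degree < (d + 1 : ℕ) → (derivative q).degree < d := by
      intro q hq
      rw [degree_lt_iff_coeff_zero] at hq ⊢
      intro m hm
      rw [coeff_derivative, hq (m + 1) (by omega), zero_mul]
    have hf' : derivative f = 0 := by
      refine ih _ (hder f hf) fun g hgd => ?_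
      rw [h.deriv_mul]
      apply hg
      rw [degree_lt_iff_coeff_zero] at hgd ⊢
      intro m hm
      have e : 2 * (X - C β) * g = C 2 * (X * g - C β * g) := by
        rw [C_ofNat]; ring
      rw [coeff_sub, coeff_derivative, e, coeff_C_mul, coeff_sub, coeff_C_mul]
      obtain ⟨m, rfl⟩ : ∃ k, m = k + 1 := ⟨m - 1, by omega⟩
      rw [coeff_X_mul, hgd m (by omega), hgd (m + 1) (by omega), hgd (m + 1 + 1) (by omega)]
      simp
    have hc := derivative_eq_zero.1 hf'
    rw [natDegree_eq_zero] at hc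
    obtain ⟨c, rfl⟩ := hc
    have h1 := hg 1 (by rw [degree_one]; exact_mod_cast Nat.succ_pos d)
    rw [mul_one, ← mul_one (C c), ← smul_eq_C_mul, map_smul, smul_eq_mul] at h1
    simpa [h.one_ne_zero] using h1

lemma eq_zero (h : IsHermiteFunctional β L) {f : ℂ[X]} (hf : ∀ g, L (f * g) = 0) : f = 0 :=
  h.eq_zero_of_degree_lt (f.natDegree + 1) f
    (lt_of_le_of_lt degree_le_natDegree (by exact_mod_cast Nat.lt_succ_self _)) fun g _ => hf g

/-- Polynomial multiples of two Gaussians with different centres only agree when they vanish. -/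
lemma eq_zero_of_ne {β' : ℂ} {L' : ℂ[X] →ₗ[ℂ] ℂ} (h : IsHermiteFunctional β L)
    (h' : IsHermiteFunctional β' L') (hne : β ≠ β') {r s : ℂ[X]}
    (hrs : ∀ p, L' (p * s) = L (p * r)) : s = 0 := by
  have key : ∀ (d : ℕ) (s r : ℂ[X]), s.degree < d → (∀ p, L' (p * s) = L (p * r)) → r = 0 := by
    intro d
    induction d with
    | zero =>
      intro s r hs hrs
      have hs0 : s = 0 := by simpa using hs
      refine h.eq_zero fun g => ?_
      rw [mul_comm, ← hrs g, hs0, mul_zero, map_zero]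
    | succ d ih =>
      intro s r hs hrs
      have h0 : C (2 * (β - β')) * r + derivative r = 0 := by
        refine ih (derivative s) _ ?_ fun p => ?_
        · rw [degree_lt_iff_coeff_zero] at hs ⊢
          intro m hm
          rw [coeff_derivative, hs (m + 1) (by omega), zero_mul]
        · have e1 := hrs (derivative p)
          rw [h.deriv_mul, h'.deriv_mul] at e1
          have e2 := hrs (2 * (X - C β') * p)
          have a1 : p * derivative s =
              2 * (X - C β') * p * s - p * (2 * (X - C β') * s - derivative s) := by ring
          have a2 : p * (C (2 * (β - β')) * r + derivative r) =
              2 * (X - C β') * p * r - p * (2 * (X - C β) * r - derivative r) := by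
            rw [C_mul, C_ofNat, C_sub]; ring
          rw [a1, a2, map_sub, map_sub, e1, e2]
      by_contra hr
      have hc : (2 * (β - β')) ≠ 0 := mul_ne_zero two_ne_zero (sub_ne_zero.2 hne)
      have h1 := degree_derivative_lt hr
      have h2 : derivative r = C (-(2 * (β - β'))) * r := by
        rw [C_neg]; linear_combination h0
      rw [h2, degree_C_mul (neg_ne_zero.2 hc)] at h1
      exact lt_irrefl _ h1
  have hr := key (s.natDegree + 1) s r
    (lt_of_le_of_lt degree_le_natDegree (by exact_mod_cast Nat.lt_succ_self _)) hrs
  refine h'.eq_zero fun g => ?_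
  rw [mul_comm, hrs, hr, mul_zero, map_zero]

end IsHermiteFunctional

/-- Commutation with multiplication by `X`. -/
def adX : Module.End ℂ (Module.End ℂ ℂ[X]) :=
  LinearMap.mulRight ℂ (LinearMap.mulLeft ℂ (X : ℂ[X])) -
    LinearMap.mulLeft ℂ (LinearMap.mulLeft ℂ (X : ℂ[X]))

lemma adX_apply (E : Module.End ℂ ℂ[X]) :
    adX E = E * LinearMap.mulLeft ℂ X - LinearMap.mulLeft ℂ X * E := rfl

lemma adX_mul (E G : Module.End ℂ ℂ[X]) : adX (E * G) = adX E * G + E * adX G := by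
  simp only [adX_apply, sub_mul, mul_sub, mul_assoc]; abel

lemma adX_mulLeft (c : ℂ[X]) : adX (LinearMap.mulLeft ℂ c) = 0 := by
  refine LinearMap.ext fun p => ?_
  simp only [adX_apply, LinearMap.sub_apply, Module.End.mul_apply, LinearMap.mulLeft_apply,
    LinearMap.zero_apply]
  ring

lemma adX_one : adX 1 = 0 := by simp [adX_apply]

lemma adX_derivative : adX (derivative : ℂ[X] →ₗ[ℂ] ℂ[X]) = 1 := by
  refine LinearMap.ext fun p => ?_
  simp [adX_apply, LinearMap.sub_apply, Module.End.mul_apply]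

lemma adX_pow_mulLeft_mul (c : ℂ[X]) (E : Module.End ℂ ℂ[X]) (k : ℕ) :
    (adX ^ k) (LinearMap.mulLeft ℂ c * E) = LinearMap.mulLeft ℂ c * (adX ^ k) E := by
  induction k with
  | zero => simp
  | succ k ih =>
    rw [pow_succ', Module.End.mul_apply, ih, adX_mul, adX_mulLeft, zero_mul, zero_add,
      Module.End.mul_apply]

lemma adX_derivative_pow (j : ℕ) :
    adX ((derivative : Module.End ℂ ℂ[X]) ^ (j + 1)) =
      ((j : ℂ) + 1) • (derivative : Module.End ℂ ℂ[X]) ^ j := by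
  induction j with
  | zero => simp [adX_derivative]
  | succ j ih =>
    rw [pow_succ, adX_mul, ih, adX_derivative, mul_one, smul_mul_assoc, ← pow_succ]
    push_cast
    module

lemma adX_pow_derivative_pow (j : ℕ) :
    (adX ^ j) ((derivative : Module.End ℂ ℂ[X]) ^ j) = (j.factorial : ℂ) • 1 := by
  induction j with
  | zero => simp
  | succ j ih =>
    rw [pow_succ, Module.End.mul_apply, adX_derivative_pow, map_smul, ih, smul_smul,
      Nat.factorial_succ]
    push_cast
    rfl

lemma adX_pow_derivative_pow_of_lt {j k : ℕ} (h : j < k) :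
    (adX ^ k) ((derivative : Module.End ℂ ℂ[X]) ^ j) = 0 := by
  obtain ⟨i, rfl⟩ : ∃ i, k = i + 1 + j := ⟨k - j - 1, by omega⟩
  rw [pow_add, Module.End.mul_apply, adX_pow_derivative_pow, map_smul, pow_succ,
    Module.End.mul_apply, adX_one, map_zero, smul_zero]

/-- The scalar differential operator `f ↦ ∑_{j ≤ n} c_j f^{(j)}`. -/
def diffOp (n : ℕ) (c : ℕ → ℂ[X]) : Module.End ℂ ℂ[X] :=
  ∑ j ∈ Finset.range (n + 1), LinearMap.mulLeft ℂ (c j) * (derivative : Module.End ℂ ℂ[X]) ^ j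

lemma diffOp_apply (n : ℕ) (c : ℕ → ℂ[X]) (p : ℂ[X]) :
    diffOp n c p = ∑ j ∈ Finset.range (n + 1), derivative^[j] p * c j := by
  simp only [diffOp, LinearMap.sum_apply, Module.End.mul_apply, Module.End.pow_apply,
    LinearMap.mulLeft_apply]
  exact Finset.sum_congr rfl fun j _ => mul_comm _ _

lemma adX_pow_diffOp (n : ℕ) (c : ℕ → ℂ[X]) :
    (adX ^ n) (diffOp n c) = (n.factorial : ℂ) • LinearMap.mulLeft ℂ (c n) := by
  rw [diffOp, map_sum, Finset.sum_range_succ, Finset.sum_eq_zero, zero_add,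
    adX_pow_mulLeft_mul, adX_pow_derivative_pow, mul_smul_comm, mul_one]
  intro j hj
  rw [adX_pow_mulLeft_mul, adX_pow_derivative_pow_of_lt (Finset.mem_range.1 hj), mul_zero]

/-- The Hermite operator `f ↦ f'' - 2 (x - β) f'`. -/
def hermiteOp (β : ℂ) : Module.End ℂ ℂ[X] :=
  (derivative : Module.End ℂ ℂ[X]) ^ 2 -
    LinearMap.mulLeft ℂ (2 * (X - C β)) * (derivative : Module.End ℂ ℂ[X])

lemma hermiteOp_apply (β : ℂ) (p : ℂ[X]) :
    hermiteOp β p = derivative (derivative p) - 2 * (X - C β) * derivative p := by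
  simp [hermiteOp, pow_two, mul_assoc]

lemma adX_hermiteOp (β : ℂ) : adX (hermiteOp β) =
    2 * (derivative : Module.End ℂ ℂ[X]) - LinearMap.mulLeft ℂ (2 * (X - C β)) := by
  rw [hermiteOp, map_sub, adX_mul, adX_mulLeft, zero_mul, zero_add, adX_derivative, mul_one,
    pow_two, adX_mul, adX_derivative]
  noncomm_ring

lemma adX_adX_hermiteOp (β : ℂ) : adX (adX (hermiteOp β)) = 2 := by
  rw [adX_hermiteOp, map_sub, adX_mulLeft, two_mul, map_add, adX_derivative]
  norm_num

lemma adX_pow_mul_hermiteOp (β : ℂ) (E : Module.End ℂ ℂ[X]) (k : ℕ) :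
    (adX ^ (k + 2)) (E * hermiteOp β) = (adX ^ (k + 2)) E * hermiteOp β +
      ((k : ℂ) + 2) • ((adX ^ (k + 1)) E * adX (hermiteOp β)) +
      (((k : ℂ) + 2) * (k + 1)) • (adX ^ k) E := by
  induction k with
  | zero =>
    simp only [pow_succ', pow_zero, Module.End.mul_apply, Module.End.one_apply, adX_mul, map_add,
      adX_adX_hermiteOp, mul_two, Nat.cast_zero, zero_add, mul_one]
    module
  | succ k ih =>
    rw [show k + 1 + 2 = (k + 2) + 1 from rfl, pow_succ', Module.End.mul_apply, ih]
    simp only [map_add, map_smul, adX_mul, adX_adX_hermiteOp, mul_two]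
    simp only [pow_succ', Module.End.mul_apply]
    push_cast
    module

lemma adX_pow_hermiteOp_pow (β : ℂ) (m : ℕ) :
    (adX ^ (2 * m)) (hermiteOp β ^ m) = ((2 * m).factorial : ℂ) • 1 := by
  induction m with
  | zero => simp
  | succ m ih =>
    have h1 : ∀ i, (adX ^ (i + 1 + 2 * m)) (hermiteOp β ^ m) = 0 := by
      intro i
      rw [pow_add, Module.End.mul_apply, ih, map_smul, pow_succ, Module.End.mul_apply, adX_one,
        map_zero, smul_zero]
    rw [pow_succ (hermiteOp β), show 2 * (m + 1) = 2 * m + 2 by ring, adX_pow_mul_hermiteOp, ih,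
      show 2 * m + 2 = 1 + 1 + 2 * m by ring, show 2 * m + 1 = 0 + 1 + 2 * m by ring, h1, h1,
      zero_mul, zero_mul, smul_zero, zero_add, zero_add, smul_smul,
      show 1 + 1 + 2 * m = 2 * m + 1 + 1 by ring, Nat.factorial_succ, Nat.factorial_succ]
    push_cast
    congr 1
    ring

lemma adX_pow_aeval_hermiteOp (β : ℂ) (p : ℂ[X]) :
    (adX ^ (2 * p.natDegree)) (aeval (hermiteOp β) p) =
      (((2 * p.natDegree).factorial : ℂ) * p.leadingCoeff) • 1 := by
  rw [aeval_eq_sum_range, map_sum, Finset.sum_range_succ, Finset.sum_eq_zero, zero_add, map_smul,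
    adX_pow_hermiteOp_pow, smul_smul, mul_comm, leadingCoeff]
  intro i hi
  have hi := Finset.mem_range.1 hi
  obtain ⟨k, hk⟩ : ∃ k, 2 * p.natDegree = k + 1 + 2 * i :=
    ⟨2 * p.natDegree - 2 * i - 1, by omega⟩
  rw [map_smul, hk, pow_add, Module.End.mul_apply, adX_pow_hermiteOp_pow, map_smul, pow_succ,
    Module.End.mul_apply, adX_one, map_zero, smul_zero, smul_zero]

/-- `E` is triangular on `ℂ[X]` for the degree filtration, with diagonal entries `μ k`. -/
def IsTriangular (E : Module.End ℂ ℂ[X]) (μ : ℕ → ℂ) : Prop :=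
  ∀ (k : ℕ) (f : ℂ[X]), f.degree < (k + 1 : ℕ) →
    (E f).degree < (k + 1 : ℕ) ∧ (E f).coeff k = μ k * f.coeff k

/-- `E` has an `L`-adjoint which does not raise degrees. -/
def HasTriangularAdjoint (L : ℂ[X] →ₗ[ℂ] ℂ) (E : Module.End ℂ ℂ[X]) : Prop :=
  ∀ (k : ℕ) (r : ℂ[X]), r.degree < k → ∃ s : ℂ[X], s.degree < k ∧ ∀ p, L (E p * r) = L (p * s)

lemma degree_sub_C_mul_X_pow_lt {k : ℕ} {f : ℂ[X]} (hf : f.degree < (k + 1 : ℕ)) :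
    (f - C (f.coeff k) * X ^ k).degree < (k : WithBot ℕ) := by
  rw [degree_lt_iff_coeff_zero] at hf ⊢
  intro m hm
  rw [coeff_sub, coeff_C_mul, coeff_X_pow]
  split_ifs with h
  · simp [h]
  · rw [hf m (by omega)]; simp

lemma isTriangular_of_degree_lt {E : Module.End ℂ ℂ[X]}
    (hE : ∀ (k : ℕ) (f : ℂ[X]), f.degree < k → (E f).degree < k) :
    IsTriangular E fun k => (E (X ^ k)).coeff k := by
  intro k f hf
  refine ⟨hE _ f hf, ?_⟩
  have h1 := hE k _ (degree_sub_C_mul_X_pow_lt hf)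
  rw [map_sub, ← smul_eq_C_mul, map_smul, degree_lt_iff_coeff_zero] at h1
  have h2 := h1 k le_rfl
  rw [coeff_sub, coeff_smul, smul_eq_mul, sub_eq_zero] at h2
  exact h2.trans (mul_comm _ _)

lemma isTriangular_hermiteOp (β : ℂ) : IsTriangular (hermiteOp β) fun k => -2 * k := by
  intro k f hf
  rw [degree_lt_iff_coeff_zero] at hf
  have e : ∀ m, (hermiteOp β f).coeff m = f.coeff (m + 2) * (m + 1 + 1) * (m + 1)
      - 2 * (f.coeff m * m) + 2 * β * (f.coeff (m + 1) * (m + 1)) := by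
    intro m
    have e1 : hermiteOp β f = derivative (derivative f) - C 2 * (X * derivative f)
        + C (2 * β) * derivative f := by
      rw [hermiteOp_apply, C_mul, C_ofNat]; ring
    rw [e1, coeff_add, coeff_sub, coeff_C_mul, coeff_C_mul]
    cases m with
    | zero => simp [coeff_derivative]
    | succ m => simp [coeff_derivative, coeff_X_mul]
  constructor
  · rw [degree_lt_iff_coeff_zero]
    intro m hm
    rw [e, hf m hm, hf (m + 1) (by omega), hf (m + 2) (by omega)]
    ring
  · rw [e, hf (k + 1) (by omega), hf (k + 2) (by omega)]
    ring

lemma isTriangular_aeval_hermiteOp (β : ℂ) (p : ℂ[X]) :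
    IsTriangular (aeval (hermiteOp β) p) fun k => p.eval (-2 * (k : ℂ)) := by
  induction p using Polynomial.induction_on with
  | C a =>
    intro k f hf
    rw [aeval_C, Module.algebraMap_end_apply, coeff_smul, smul_eq_mul]
    exact ⟨lt_of_le_of_lt (degree_smul_le _ _) hf, by simp⟩
  | add p q hp hq =>
    intro k f hf
    rw [map_add, LinearMap.add_apply, coeff_add, (hp k f hf).2, (hq k f hf).2]
    exact ⟨lt_of_le_of_lt (degree_add_le _ _) (max_lt (hp k f hf).1 (hq k f hf).1),
      by simp [add_mul]⟩
  | monomial m a ih =>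
    intro k f hf
    obtain ⟨h1, h2⟩ := isTriangular_hermiteOp β k f hf
    have h3 := ih k _ h1
    rw [pow_succ, ← mul_assoc, map_mul, aeval_X, Module.End.mul_apply]
    refine ⟨h3.1, ?_⟩
    rw [h3.2, h2]
    simp only [eval_mul, eval_X]
    ring

lemma IsHermiteFunctional.hasTriangularAdjoint_hermiteOp {β : ℂ} {L : ℂ[X] →ₗ[ℂ] ℂ}
    (h : IsHermiteFunctional β L) : HasTriangularAdjoint L (hermiteOp β) := by
  intro k r hr
  refine ⟨hermiteOp β r, ?_, fun p => ?_⟩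
  · cases k with
    | zero =>
      have : r = 0 := by simpa using hr
      simp [this]
    | succ k => exact (isTriangular_hermiteOp β k r hr).1
  · have h1 := h.deriv_mul (derivative p) r
    have h2 := h.deriv_mul p (derivative r)
    have e1 : hermiteOp β p * r = derivative (derivative p) * r
        - derivative p * (2 * (X - C β) * r) := by rw [hermiteOp_apply]; ring
    have e2 : p * hermiteOp β r = - (p * (2 * (X - C β) * derivative r
        - derivative (derivative r))) := by rw [hermiteOp_apply]; ring
    rw [e1, e2, map_sub, h1, map_neg, ← h2, ← map_sub, ← map_neg]
    congr 1
    ring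

lemma HasTriangularAdjoint.aeval {L : ℂ[X] →ₗ[ℂ] ℂ} {E : Module.End ℂ ℂ[X]}
    (h : HasTriangularAdjoint L E) (p : ℂ[X]) : HasTriangularAdjoint L (aeval E p) := by
  induction p using Polynomial.induction_on with
  | C a =>
    intro k r hr
    refine ⟨a • r, lt_of_le_of_lt (degree_smul_le _ _) hr, fun p => ?_⟩
    rw [aeval_C, Module.algebraMap_end_apply, smul_mul_assoc, mul_smul_comm]
  | add p q hp hq =>
    intro k r hr
    obtain ⟨s, hs, hs'⟩ := hp k r hr
    obtain ⟨t, ht, ht'⟩ := hq k r hr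
    refine ⟨s + t, lt_of_le_of_lt (degree_add_le _ _) (max_lt hs ht), fun f => ?_⟩
    rw [map_add, LinearMap.add_apply, add_mul, mul_add, map_add, map_add, hs', ht']
  | monomial m a ih =>
    intro k r hr
    obtain ⟨s, hs, hs'⟩ := ih k r hr
    obtain ⟨t, ht, ht'⟩ := h k s hs
    refine ⟨t, ht, fun f => ?_⟩
    rw [pow_succ, ← mul_assoc, map_mul (Polynomial.aeval E), aeval_X, Module.End.mul_apply, hs', ht']

/-- A triangular operator with triangular adjoint is a function of the Hermite operator as soon as
its eigenvalues are. -/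
lemma IsHermiteFunctional.eq_aeval_hermiteOp {β : ℂ} {L : ℂ[X] →ₗ[ℂ] ℂ}
    (h : IsHermiteFunctional β L) {E : Module.End ℂ ℂ[X]} {p : ℂ[X]}
    (hE : IsTriangular E fun k => p.eval (-2 * (k : ℂ))) (hE' : HasTriangularAdjoint L E) :
    E = Polynomial.aeval (hermiteOp β) p := by
  have key : ∀ (k : ℕ) (f : ℂ[X]), f.degree < k →
      (E - Polynomial.aeval (hermiteOp β) p) f = 0 := by
    intro k
    induction k with
    | zero =>
      intro f hf
      have : f = 0 := by simpa using hf
      rw [this, map_zero]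
    | succ k ih =>
      intro f hf
      obtain ⟨h1, h2⟩ := hE k f hf
      obtain ⟨h3, h4⟩ := isTriangular_aeval_hermiteOp β p k f hf
      refine h.eq_zero_of_degree_lt k _ ?_ fun g hg => ?_
      · rw [degree_lt_iff_coeff_zero] at h1 h3 ⊢
        intro m hm
        rw [LinearMap.sub_apply, coeff_sub]
        rcases hm.eq_or_lt with rfl | hm
        · rw [h2, h4, sub_self]
        · rw [h1 m hm, h3 m hm, sub_self]
      · obtain ⟨s, hs, hs'⟩ := hE' k g hg
        obtain ⟨t, ht, ht'⟩ := h.hasTriangularAdjoint_hermiteOp.aeval p k g hg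
        have hst : ∀ q, L ((E - Polynomial.aeval (hermiteOp β) p) q * g) = L (q * (s - t)) := by
          intro q
          rw [LinearMap.sub_apply, sub_mul, mul_sub, map_sub, map_sub, hs', ht']
        have h0 : s - t = 0 := by
          refine h.eq_zero_of_degree_lt k _
            (lt_of_le_of_lt (degree_sub_le _ _) (max_lt hs ht)) fun q hq => ?_
          rw [mul_comm, ← hst, ih q hq, zero_mul, map_zero]
        rw [hst, h0, mul_zero, map_zero]
  refine sub_eq_zero.1 (LinearMap.ext fun f => ?_)
  exact key (f.natDegree + 1) f
    (lt_of_le_of_lt degree_le_natDegree (by exact_mod_cast Nat.lt_succ_self _))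

lemma exists_eval_eq_coeff_diffOp (n : ℕ) (c : ℕ → ℂ[X]) :
    ∃ p : ℂ[X], ∀ k : ℕ, p.eval (-2 * (k : ℂ)) = (diffOp n c (X ^ k)).coeff k := by
  refine ⟨(∑ j ∈ Finset.range (n + 1), C ((c j).coeff j) * descPochhammer ℂ j).comp
    (C (-1 / 2) * X), fun k => ?_⟩
  rw [eval_comp, eval_mul, eval_C, eval_X, show (-1 / 2 : ℂ) * (-2 * k) = k by ring, eval_finsetSum,
    diffOp_apply, finsetSum_coeff]
  refine Finset.sum_congr rfl fun j _ => ?_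
  rw [eval_mul, eval_C, descPochhammer_eval_eq_descFactorial,
    iterate_derivative_X_pow_eq_natCast_mul, mul_assoc, ← C_eq_natCast, coeff_C_mul,
    X_pow_mul, coeff_mul_X_pow']
  rcases le_or_gt j k with h | h
  · rw [if_pos (Nat.sub_le _ _), Nat.sub_sub_self h, mul_comm]
  · simp [Nat.descFactorial_of_lt h]

lemma IsHermiteFunctional.exists_adjoint_diffOp {β : ℂ} {L : ℂ[X] →ₗ[ℂ] ℂ}
    (h : IsHermiteFunctional β L) (n : ℕ) (c : ℕ → ℂ[X]) (q : ℂ[X]) :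
    ∃ s : ℂ[X], ∀ p, L (diffOp n c p * q) = L (p * s) := by
  have key : ∀ (j : ℕ) (r : ℂ[X]), ∃ s : ℂ[X], ∀ p, L (derivative^[j] p * r) = L (p * s) := by
    intro j
    induction j with
    | zero => exact fun r => ⟨r, fun p => rfl⟩
    | succ j ih =>
      intro r
      obtain ⟨s, hs⟩ := ih (2 * (X - C β) * r - derivative r)
      refine ⟨s, fun p => ?_⟩
      rw [Function.iterate_succ_apply', h.deriv_mul, hs]
  choose s hs using fun j => key j (c j * q)
  refine ⟨∑ j ∈ Finset.range (n + 1), s j, fun p => ?_⟩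
  rw [diffOp_apply, Finset.sum_mul, Finset.mul_sum, map_sum, map_sum]
  refine Finset.sum_congr rfl fun j _ => ?_
  rw [mul_assoc, hs]

section MatrixOperators

variable {N : ℕ}

/-- The matrix polynomial `I + x A`. -/
def shear (A : Matrix (Fin N) (Fin N) ℂ) : Matrix (Fin N) (Fin N) ℂ[X] :=
  1 + (X : ℂ[X]) • A.map C

lemma vecMul_shear_apply (A : Matrix (Fin N) (Fin N) ℂ) (v : Fin N → ℂ[X]) (t : Fin N) :
    (v ᵥ* shear A) t = v t + X * ∑ u, v u * C (A u t) := by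
  rw [shear, vecMul_add, vecMul_one, vecMul_smul, Pi.add_apply, Pi.smul_apply, smul_eq_mul]
  rfl

lemma shear_mul_shear_neg {A : Matrix (Fin N) (Fin N) ℂ} (hA : A * A = 0) :
    shear A * shear (-A) = 1 := by
  have h1 : A.map C * A.map C = (0 : Matrix (Fin N) (Fin N) ℂ[X]) := by
    rw [← Matrix.map_mul, hA]; simp
  have h2 : (-A).map C = -(A.map C : Matrix (Fin N) (Fin N) ℂ[X]) := by
    ext1 i j; simp
  have h3 : (X : ℂ[X]) • (A.map C : Matrix (Fin N) (Fin N) ℂ[X]) * (X : ℂ[X]) • A.map C = 0 := by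
    rw [Matrix.smul_mul, Matrix.mul_smul, h1, smul_zero, smul_zero]
  rw [shear, shear, h2, smul_neg, add_mul, mul_add, mul_add, mul_neg, mul_neg, h3]
  simp

lemma vecMul_shear_neg_shear {A : Matrix (Fin N) (Fin N) ℂ} (hA : A * A = 0) (v : Fin N → ℂ[X]) :
    v ᵥ* shear (-A) ᵥ* shear A = v := by
  have h := shear_mul_shear_neg (A := -A) (by simpa using hA)
  rw [neg_neg] at h
  rw [vecMul_vecMul, h, vecMul_one]

lemma vecMul_shear_shear_neg {A : Matrix (Fin N) (Fin N) ℂ} (hA : A * A = 0) (v : Fin N → ℂ[X]) :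
    v ᵥ* shear A ᵥ* shear (-A) = v := by
  rw [vecMul_vecMul, shear_mul_shear_neg hA, vecMul_one]

/-- The action of the matrix differential operator `∑_{j ≤ n} ∂^j F_j` on rows of polynomials. -/
def matOp (n : ℕ) (F : ℕ → Matrix (Fin N) (Fin N) ℂ[X]) :
    (Fin N → ℂ[X]) →ₗ[ℂ] (Fin N → ℂ[X]) :=
  LinearMap.pi fun t => ∑ s, (diffOp n fun j => F j s t) ∘ₗ LinearMap.proj s

lemma matOp_apply (n : ℕ) (F : ℕ → Matrix (Fin N) (Fin N) ℂ[X]) (p : Fin N → ℂ[X]) (t : Fin N) :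
    matOp n F p t = ∑ s, diffOp n (fun j => F j s t) (p s) := by
  simp [matOp, LinearMap.sum_apply]

/-- Rows of polynomials of degree `< k`. -/
def rowDegreeLT (N k : ℕ) : Submodule ℂ (Fin N → ℂ[X]) :=
  Submodule.pi Set.univ fun _ => degreeLT ℂ k

lemma mem_rowDegreeLT {k : ℕ} {p : Fin N → ℂ[X]} :
    p ∈ rowDegreeLT N k ↔ ∀ t, (p t).degree < k := by
  simp [rowDegreeLT, Submodule.mem_pi, mem_degreeLT]

/-- The rows of the `k`-th matrix are monic of degree `k`. -/
def IsMonicFamily (P : ℕ → Matrix (Fin N) (Fin N) ℂ[X]) : Prop :=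
  ∀ k s t, (P k s t).degree < (k + 1 : ℕ) ∧ (P k s t).coeff k = (1 : Matrix (Fin N) (Fin N) ℂ) s t

lemma IsMonicFamily.mem_rowDegreeLT {P : ℕ → Matrix (Fin N) (Fin N) ℂ[X]} (hP : IsMonicFamily P)
    {m k : ℕ} (hmk : m < k) (s : Fin N) : P m s ∈ rowDegreeLT N k :=
  _root_.mem_rowDegreeLT.2 fun t => lt_of_lt_of_le (hP m s t).1 (by exact_mod_cast hmk)

lemma IsMonicFamily.rowDegreeLT_le_span {P : ℕ → Matrix (Fin N) (Fin N) ℂ[X]}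
    (hP : IsMonicFamily P) (k : ℕ) :
    rowDegreeLT N k ≤ Submodule.span ℂ {v | ∃ m < k, ∃ s, v = P m s} := by
  induction k with
  | zero =>
    intro p hp
    have : p = 0 := by
      funext t
      simpa using _root_.mem_rowDegreeLT.1 hp t
    rw [this]
    exact zero_mem _
  | succ k ih =>
    intro p hp
    have h1 : p - ∑ s, (p s).coeff k • P k s ∈ rowDegreeLT N k := by
      refine _root_.mem_rowDegreeLT.2 fun t => ?_
      have hpt := _root_.mem_rowDegreeLT.1 hp t
      rw [degree_lt_iff_coeff_zero] at hpt ⊢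
      intro m hm
      simp only [Pi.sub_apply, Finset.sum_apply, Pi.smul_apply, coeff_sub, finsetSum_coeff,
        coeff_smul, smul_eq_mul]
      rcases hm.eq_or_lt with rfl | hm
      · simp only [(hP k _ t).2, Matrix.one_apply]
        simp
      · rw [hpt m hm, Finset.sum_eq_zero, sub_zero]
        intro s _
        rw [(degree_lt_iff_coeff_zero _ _).1 (hP k s t).1 m hm, mul_zero]
    have h2 : ∑ s, (p s).coeff k • P k s ∈
        Submodule.span ℂ {v | ∃ m < k + 1, ∃ s, v = P m s} :=
      Submodule.sum_mem _ fun s _ => Submodule.smul_mem _ _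
        (Submodule.subset_span ⟨k, Nat.lt_succ_self k, s, rfl⟩)
    have h3 := Submodule.span_mono (R := ℂ) (s := {v | ∃ m < k, ∃ s, v = P m s})
      (t := {v | ∃ m < k + 1, ∃ s, v = P m s})
      (fun v ⟨m, hm, h⟩ => ⟨m, hm.trans (Nat.lt_succ_self k), h⟩) (ih h1)
    simpa using add_mem h3 h2

lemma exists_mem_rowDegreeLT (p : Fin N → ℂ[X]) : ∃ k, p ∈ rowDegreeLT N k := by
  refine ⟨(Finset.univ.sup fun t => (p t).natDegree) + 1, mem_rowDegreeLT.2 fun t => ?_⟩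
  refine lt_of_le_of_lt degree_le_natDegree ?_
  exact_mod_cast Nat.lt_succ_of_le (Finset.le_sup (f := fun t => (p t).natDegree)
    (Finset.mem_univ t))

lemma matOp_mem_rowDegreeLT {n : ℕ} {F P : ℕ → Matrix (Fin N) (Fin N) ℂ[X]}
    {Λ : ℕ → Matrix (Fin N) (Fin N) ℂ} (hP : IsMonicFamily P)
    (heig : ∀ k s, matOp n F (P k s) = ∑ u, Λ k s u • P k u)
    {k : ℕ} {p : Fin N → ℂ[X]} (hp : p ∈ rowDegreeLT N k) : matOp n F p ∈ rowDegreeLT N k := by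
  have h : Submodule.span ℂ {v | ∃ m < k, ∃ s, v = P m s} ≤ (rowDegreeLT N k).comap (matOp n F) := by
    rw [Submodule.span_le]
    rintro v ⟨m, hm, s, rfl⟩
    rw [SetLike.mem_coe, Submodule.mem_comap, heig]
    exact Submodule.sum_mem _ fun u _ => Submodule.smul_mem _ _ (hP.mem_rowDegreeLT hm u)
  exact h (hP.rowDegreeLT_le_span k hp)

/-- The bilinear pairing `∑ᵢ Lᵢ((p T)ᵢ (q T)ᵢ)` with `T = I + x A`. -/
def shearForm (L : Fin N → ℂ[X] →ₗ[ℂ] ℂ) (A : Matrix (Fin N) (Fin N) ℂ) :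
    (Fin N → ℂ[X]) →ₗ[ℂ] (Fin N → ℂ[X]) →ₗ[ℂ] ℂ :=
  LinearMap.mk₂ ℂ (fun p q => ∑ i, L i ((p ᵥ* shear A) i * (q ᵥ* shear A) i))
    (by intro p p' q; simp [add_vecMul, add_mul, Finset.sum_add_distrib])
    (by intro c p q; simp [smul_vecMul, Finset.mul_sum])
    (by intro p q q'; simp [add_vecMul, mul_add, Finset.sum_add_distrib])
    (by intro c p q; simp [smul_vecMul, Finset.mul_sum])

lemma shearForm_apply (L : Fin N → ℂ[X] →ₗ[ℂ] ℂ) (A : Matrix (Fin N) (Fin N) ℂ)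
    (p q : Fin N → ℂ[X]) :
    shearForm L A p q = ∑ i, L i ((p ᵥ* shear A) i * (q ᵥ* shear A) i) := rfl

variable {A : Matrix (Fin N) (Fin N) ℂ} {β : Fin N → ℂ} {L : Fin N → ℂ[X] →ₗ[ℂ] ℂ}

lemma shearForm_single_left (hA : A * A = 0) (i : Fin N) (f : ℂ[X]) (q : Fin N → ℂ[X]) :
    shearForm L A (Pi.single i f ᵥ* shear (-A)) q = L i (f * (q ᵥ* shear A) i) := by
  rw [shearForm_apply, vecMul_shear_neg_shear hA, Finset.sum_eq_single i]
  · rw [Pi.single_eq_same]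
  · intro j _ hj
    rw [Pi.single_eq_of_ne hj, zero_mul, map_zero]
  · simp

lemma shearForm_single_right (hA : A * A = 0) (i : Fin N) (f : ℂ[X]) (p : Fin N → ℂ[X]) :
    shearForm L A p (Pi.single i f ᵥ* shear (-A)) = L i ((p ᵥ* shear A) i * f) := by
  rw [shearForm_apply, vecMul_shear_neg_shear hA, Finset.sum_eq_single i]
  · rw [Pi.single_eq_same]
  · intro j _ hj
    rw [Pi.single_eq_of_ne hj, mul_zero, map_zero]
  · simp

lemma eq_zero_of_shearForm_eq_zero (hL : ∀ i, IsHermiteFunctional (β i) (L i)) (hA : A * A = 0)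
    {q : Fin N → ℂ[X]} (h : ∀ p, shearForm L A p q = 0) : q = 0 := by
  have h1 : q ᵥ* shear A = 0 := by
    funext i
    refine (hL i).eq_zero fun g => ?_
    rw [mul_comm, ← shearForm_single_left hA, h]
  rw [← vecMul_shear_shear_neg hA q, h1, zero_vecMul]

lemma IsMonicFamily.eq_of_forall {P : ℕ → Matrix (Fin N) (Fin N) ℂ[X]} (hP : IsMonicFamily P)
    {f g : (Fin N → ℂ[X]) →ₗ[ℂ] ℂ} (h : ∀ m s, f (P m s) = g (P m s)) : f = g := by
  refine LinearMap.ext fun p => ?_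
  obtain ⟨k, hk⟩ := exists_mem_rowDegreeLT p
  have h1 : Submodule.span ℂ {v | ∃ m < k, ∃ s, v = P m s} ≤ LinearMap.eqLocus f g := by
    rw [Submodule.span_le]
    rintro v ⟨m, -, s, rfl⟩
    exact h m s
  exact h1 (hP.rowDegreeLT_le_span k hk)

/-- An operator with biorthogonal eigenfunctions has an adjoint preserving degrees. -/
lemma exists_shearForm_adjoint (hL : ∀ i, IsHermiteFunctional (β i) (L i)) (hA : A * A = 0)
    {n : ℕ} {F P Q : ℕ → Matrix (Fin N) (Fin N) ℂ[X]} {Λ : ℕ → Matrix (Fin N) (Fin N) ℂ}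
    (hP : IsMonicFamily P) (hQ : IsMonicFamily Q)
    (horth : ∀ n m, n ≠ m → ∀ s t, shearForm L A (P n s) (Q m t) = 0)
    (heig : ∀ k s, matOp n F (P k s) = ∑ u, Λ k s u • P k u)
    {k : ℕ} {q : Fin N → ℂ[X]} (hq : q ∈ rowDegreeLT N k) :
    ∃ q' ∈ rowDegreeLT N k, ∀ p, shearForm L A (matOp n F p) q = shearForm L A p q' := by
  have hspan := hQ.rowDegreeLT_le_span k hq
  clear hq
  induction hspan using Submodule.span_induction with
  | zero => exact ⟨0, zero_mem _, fun p => by simp⟩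
  | add x y _ _ ihx ihy =>
    obtain ⟨x', hx, hx'⟩ := ihx
    obtain ⟨y', hy, hy'⟩ := ihy
    exact ⟨x' + y', add_mem hx hy, fun p => by rw [map_add, map_add, hx', hy']⟩
  | smul c x _ ihx =>
    obtain ⟨x', hx, hx'⟩ := ihx
    exact ⟨c • x', Submodule.smul_mem _ _ hx, fun p => by rw [map_smul, map_smul, hx']⟩
  | mem v hv =>
    obtain ⟨m, hm, t, rfl⟩ := hv
    set S : Matrix (Fin N) (Fin N) ℂ := Matrix.of fun s t => shearForm L A (P m s) (Q m t) with hS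
    have hSu : IsUnit S := by
      rw [← mulVec_injective_iff_isUnit]
      refine (injective_iff_map_eq_zero (mulVecLin S)).2 fun d hd => ?_
      have h0 : ∑ u, d u • Q m u = 0 := by
        refine eq_zero_of_shearForm_eq_zero (A := A) hL hA fun p => ?_
        have h1 : (shearForm L A).flip (∑ u, d u • Q m u) = 0 := by
          refine hP.eq_of_forall fun k s => ?_
          rw [LinearMap.flip_apply, map_sum, LinearMap.zero_apply]
          by_cases hkm : k = m
          · subst hkm
            have h2 := congrFun hd s
            rw [mulVecLin_apply, mulVec, dotProduct, Pi.zero_apply] at h2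
            rw [← h2]
            refine Finset.sum_congr rfl fun u _ => ?_
            rw [map_smul, smul_eq_mul, mul_comm, hS, of_apply]
          · refine Finset.sum_eq_zero fun u _ => ?_
            rw [map_smul, horth k m hkm, smul_zero]
        rw [← LinearMap.flip_apply, h1, LinearMap.zero_apply]
      funext i
      have h1 := congrArg (fun f => coeff f m) (congrFun h0 i)
      simp only [Finset.sum_apply, Pi.smul_apply, finsetSum_coeff, coeff_smul, smul_eq_mul,
        (hQ m _ i).2, Matrix.one_apply] at h1
      simpa using h1
    set d := S⁻¹ * (Λ m * S) with hd
    have hSd : S * d = Λ m * S :=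
      mul_nonsing_inv_cancel_left _ _ ((isUnit_iff_isUnit_det _).1 hSu)
    refine ⟨∑ u, d u t • Q m u, Submodule.sum_mem _ fun u _ =>
      Submodule.smul_mem _ _ (hQ.mem_rowDegreeLT hm u), fun p => ?_⟩
    have h1 : (shearForm L A).flip (Q m t) ∘ₗ matOp n F =
        (shearForm L A).flip (∑ u, d u t • Q m u) := by
      refine hP.eq_of_forall fun k s => ?_
      rw [LinearMap.comp_apply, heig, LinearMap.flip_apply, LinearMap.flip_apply, map_sum, map_sum,
        LinearMap.sum_apply]
      by_cases hkm : k = m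
      · subst hkm
        have h2 := congrFun (congrFun hSd s) t
        rw [Matrix.mul_apply, Matrix.mul_apply] at h2
        calc _ = ∑ u, Λ k s u * S u t := Finset.sum_congr rfl fun u _ => by
              rw [map_smul, LinearMap.smul_apply, smul_eq_mul, hS, of_apply]
          _ = ∑ u, S s u * d u t := h2.symm
          _ = _ := Finset.sum_congr rfl fun u _ => by
              rw [map_smul, smul_eq_mul, mul_comm, hS, of_apply]
      · rw [Finset.sum_eq_zero, Finset.sum_eq_zero]
        · intro u _
          rw [map_smul, horth k m hkm, smul_zero]
        · intro u _
          rw [map_smul, LinearMap.smul_apply, horth k m hkm, smul_zero]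
    exact LinearMap.congr_fun h1 p

/-- The `(i, j)` block of the operator obtained by conjugating with `I + x A`. -/
def shearConj (A : Matrix (Fin N) (Fin N) ℂ) (D : (Fin N → ℂ[X]) →ₗ[ℂ] (Fin N → ℂ[X]))
    (i j : Fin N) : Module.End ℂ ℂ[X] :=
  { toFun := fun p => (D (Pi.single i p ᵥ* shear (-A)) ᵥ* shear A) j
    map_add' := by intro p q; simp [Pi.single_add, add_vecMul]
    map_smul' := by intro c p; simp [Pi.single_smul, smul_vecMul] }

lemma shearConj_apply (D : (Fin N → ℂ[X]) →ₗ[ℂ] (Fin N → ℂ[X])) (i j : Fin N) (p : ℂ[X]) :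
    shearConj A D i j p = (D (Pi.single i p ᵥ* shear (-A)) ᵥ* shear A) j := rfl

lemma exists_adjoint_shearConj (hL : ∀ i, IsHermiteFunctional (β i) (L i)) (n : ℕ)
    (F : ℕ → Matrix (Fin N) (Fin N) ℂ[X]) (i j : Fin N) (q : ℂ[X]) :
    ∃ s : ℂ[X], ∀ p, L j (shearConj A (matOp n F) i j p * q) = L j (p * s) := by
  choose r hr using fun s t => (hL j).exists_adjoint_diffOp n (fun l => F l s t) (shear A t j * q)
  refine ⟨∑ t, ∑ s, shear (-A) i s * r s t, fun p => ?_⟩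
  rw [shearConj_apply, vecMul, dotProduct, Finset.sum_mul, Finset.mul_sum, map_sum, map_sum]
  refine Finset.sum_congr rfl fun t _ => ?_
  rw [matOp_apply, mul_assoc, Finset.sum_mul, Finset.mul_sum, map_sum, map_sum]
  refine Finset.sum_congr rfl fun s _ => ?_
  rw [hr, ← mul_assoc]
  congr 2
  simp [vecMul, dotProduct, Pi.single_apply]

/-- Conjugation by `I + x A` diagonalises an operator admitting a polynomial adjoint. -/
lemma shearConj_eq_zero_of_ne (hL : ∀ i, IsHermiteFunctional (β i) (L i))
    (hβ : Function.Injective β) (hA : A * A = 0) {n : ℕ} {F : ℕ → Matrix (Fin N) (Fin N) ℂ[X]}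
    (hadj : ∀ q, ∃ q', ∀ p, shearForm L A (matOp n F p) q = shearForm L A p q')
    {i j : Fin N} (hij : i ≠ j) : shearConj A (matOp n F) i j = 0 := by
  refine LinearMap.ext fun p => (hL j).eq_zero fun q => ?_
  obtain ⟨s, hs⟩ := exists_adjoint_shearConj (A := A) hL n F i j q
  obtain ⟨q', hq'⟩ := hadj (Pi.single j q ᵥ* shear (-A))
  have h : s = 0 := by
    refine (hL i).eq_zero_of_ne (hL j) (hβ.ne hij) (r := (q' ᵥ* shear A) i) fun p => ?_
    rw [← hs, shearConj_apply, ← shearForm_single_right hA, hq', shearForm_single_left hA]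
  rw [hs, h, mul_zero, map_zero]

lemma matOp_eq_of_shearConj (hA : A * A = 0) {D : (Fin N → ℂ[X]) →ₗ[ℂ] (Fin N → ℂ[X])}
    (hD : ∀ i j, i ≠ j → shearConj A D i j = 0) (p : Fin N → ℂ[X]) :
    D p ᵥ* shear A = fun i => shearConj A D i i ((p ᵥ* shear A) i) := by
  funext j
  have h1 : p = ∑ i, Pi.single i ((p ᵥ* shear A) i) ᵥ* shear (-A) := by
    rw [← Matrix.sum_vecMul, Finset.univ_sum_single, vecMul_shear_shear_neg hA]
  conv_lhs => rw [h1, map_sum, Matrix.sum_vecMul, Finset.sum_apply]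
  rw [Finset.sum_eq_single j]
  · rfl
  · intro i _ hij
    rw [← shearConj_apply, hD i j hij, LinearMap.zero_apply]
  · simp

lemma apply_single_eq (hA : ∀ s t u, A s t * A t u = 0)
    {D : (Fin N → ℂ[X]) →ₗ[ℂ] (Fin N → ℂ[X])} (hD : ∀ i j, i ≠ j → shearConj A D i j = 0)
    (s t : Fin N) (p : ℂ[X]) :
    D (Pi.single s p) t = (if s = t then shearConj A D s s p else 0) +
      A s t • (shearConj A D t t (X * p) - X * shearConj A D s s p) := by
  have hA' : A * A = 0 := by
    ext1 i j
    rw [Matrix.mul_apply, Finset.sum_eq_zero fun u _ => hA i u j, Matrix.zero_apply]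
  have hss : ∀ s, A s s = 0 := fun s => mul_self_eq_zero.1 (hA s s s)
  have hw : ∀ u, shearConj A D u u ((Pi.single s p ᵥ* shear A) u) =
      (if s = u then shearConj A D s s p else 0) + A s u • shearConj A D u u (X * p) := by
    intro u
    have : (Pi.single s p ᵥ* shear A) u = (if s = u then p else 0) + A s u • (X * p) := by
      rw [vecMul_shear_apply, Finset.sum_eq_single s]
      · simp only [Pi.single_apply, smul_eq_C_mul, eq_comm (a := u), if_true]
        ring
      · intro v _ hv
        rw [Pi.single_eq_of_ne hv, zero_mul]
      · simp
    rw [this, map_add, map_smul]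
    congr 1
    split_ifs with h
    · rw [h]
    · rw [map_zero]
  rw [← vecMul_shear_shear_neg hA' (D (Pi.single s p)), matOp_eq_of_shearConj hA' hD,
    vecMul_shear_apply, hw, Finset.sum_eq_single s]
  · rw [hw, if_pos rfl, hss, zero_smul, add_zero, Matrix.neg_apply, C_neg, smul_sub,
      smul_eq_C_mul, smul_eq_C_mul]
    ring
  · intro u _ hu
    rw [hw, if_neg hu.symm, zero_add, Matrix.neg_apply, C_neg, smul_eq_C_mul, mul_neg, mul_comm,
      ← mul_assoc, ← C_mul, mul_comm (A u t), hA, C_0, zero_mul, neg_zero]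
  · simp

lemma hasTriangularAdjoint_shearConj (hL : ∀ i, IsHermiteFunctional (β i) (L i))
    (hA : ∀ s t u, A s t * A t u = 0) {D : (Fin N → ℂ[X]) →ₗ[ℂ] (Fin N → ℂ[X])}
    (hD : ∀ i j, i ≠ j → shearConj A D i j = 0)
    (hadj : ∀ k, ∀ q ∈ rowDegreeLT N k,
      ∃ q' ∈ rowDegreeLT N k, ∀ p, shearForm L A (D p) q = shearForm L A p q') (s : Fin N) :
    HasTriangularAdjoint (L s) (shearConj A D s s) := by
  have hA' : A * A = 0 := by
    ext1 i j
    rw [Matrix.mul_apply, Finset.sum_eq_zero fun u _ => hA i u j, Matrix.zero_apply]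
  intro k r hr
  obtain ⟨q', hq', h⟩ := hadj k (Pi.single s r) (mem_rowDegreeLT.2 fun t => by
    by_cases hts : t = s
    · subst hts; rwa [Pi.single_eq_same]
    · rw [Pi.single_eq_of_ne hts, degree_zero]; exact WithBot.bot_lt_coe k)
  have hsingle : ∀ u, (Pi.single s r ᵥ* shear A) u = (if u = s then r else 0) + X * (r * C (A s u)) := by
    intro u
    rw [vecMul_shear_apply, Finset.sum_eq_single s]
    · rw [Pi.single_eq_same, Pi.single_apply]
    · intro v _ hv
      rw [Pi.single_eq_of_ne hv, zero_mul]
    · simp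
  have hcomp : ∀ i p, L i (shearConj A D i i p * (Pi.single s r ᵥ* shear A) i) =
      L i (p * (q' ᵥ* shear A) i) := by
    intro i p
    have h1 := h (Pi.single i p ᵥ* shear (-A))
    rw [shearForm_single_left hA', shearForm_apply, Finset.sum_eq_single i] at h1
    · rw [← h1, shearConj_apply]
    · intro j _ hj
      rw [← shearConj_apply, hD i j hj.symm, LinearMap.zero_apply, zero_mul, map_zero]
    · simp
  have hcol : ∀ u, q' u * C (A u s) = 0 := by
    intro u
    by_cases hus : A u s = 0
    · rw [hus, C_0, mul_zero]
    have hsu : A s u = 0 := (mul_eq_zero.1 (hA u s u)).resolve_left hus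
    have hne : u ≠ s := by
      rintro rfl
      exact hus hsu
    have h1 : (q' ᵥ* shear A) u = 0 := by
      refine (hL u).eq_zero fun p => ?_
      rw [mul_comm, ← hcomp, hsingle, if_neg hne, hsu]
      simp
    rw [vecMul_shear_apply, Finset.sum_eq_zero, mul_zero, add_zero] at h1
    · rw [h1, zero_mul]
    · intro v _
      rw [(mul_eq_zero.1 (hA v u s)).resolve_right hus, C_0, mul_zero]
  refine ⟨q' s, mem_rowDegreeLT.1 hq' s, fun p => ?_⟩
  have h1 := hcomp s p
  rwa [hsingle, if_pos rfl, mul_self_eq_zero.1 (hA s s s), vecMul_shear_apply,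
    Finset.sum_eq_zero fun u _ => hcol u, C_0, mul_zero, mul_zero, add_zero, add_zero] at h1

lemma adX_pow_mul_mulLeft (E : Module.End ℂ ℂ[X]) (c : ℂ[X]) (k : ℕ) :
    (adX ^ k) (E * LinearMap.mulLeft ℂ c) = (adX ^ k) E * LinearMap.mulLeft ℂ c := by
  induction k with
  | zero => simp
  | succ k ih =>
    rw [pow_succ', Module.End.mul_apply, ih, adX_mul, adX_mulLeft, mul_zero, add_zero,
      Module.End.mul_apply]

/-- A matrix differential operator having two biorthogonal monic families, attached to the weight
`T diag(w) T^*` with `T = I + x A`, as eigenfunctions has even order and scalar leading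
coefficient. -/
theorem even_and_leading_scalar (hN : 0 < N) (hL : ∀ i, IsHermiteFunctional (β i) (L i))
    (hβ : Function.Injective β) (hA : ∀ s t u, A s t * A t u = 0)
    (hcon : ∀ i j : Fin N, (i : ℕ) + 1 = j → A i j ≠ 0 ∨ A j i ≠ 0)
    {n : ℕ} {F P Q : ℕ → Matrix (Fin N) (Fin N) ℂ[X]} {Λ : ℕ → Matrix (Fin N) (Fin N) ℂ}
    (hP : IsMonicFamily P) (hQ : IsMonicFamily Q)
    (horth : ∀ n m, n ≠ m → ∀ s t, shearForm L A (P n s) (Q m t) = 0)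
    (heig : ∀ k s, matOp n F (P k s) = ∑ u, Λ k s u • P k u) (hF : F n ≠ 0) :
    Even n ∧ ∃ c : ℂ, ∀ s t, F n s t = if s = t then C c else 0 := by
  have hA' : A * A = 0 := by
    ext1 i j
    rw [Matrix.mul_apply, Finset.sum_eq_zero fun u _ => hA i u j, Matrix.zero_apply]
  have hss : ∀ s, A s s = 0 := fun s => mul_self_eq_zero.1 (hA s s s)
  have hadj := fun k q (hq : q ∈ rowDegreeLT N k) =>
    exists_shearForm_adjoint hL hA' hP hQ horth heig hq
  have hdiag : ∀ i j, i ≠ j → shearConj A (matOp n F) i j = 0 := by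
    refine fun i j hij => shearConj_eq_zero_of_ne hL hβ hA' (fun q => ?_) hij
    obtain ⟨k, hk⟩ := exists_mem_rowDegreeLT q
    obtain ⟨q', -, h⟩ := hadj k q hk
    exact ⟨q', h⟩
  set E : Fin N → Module.End ℂ ℂ[X] := fun s => shearConj A (matOp n F) s s with hE
  have hsingle : ∀ s t p, matOp n F (Pi.single s p) t = diffOp n (fun j => F j s t) p := by
    intro s t p
    rw [matOp_apply, Finset.sum_eq_single s]
    · rw [Pi.single_eq_same]
    · intro u _ hu
      rw [Pi.single_eq_of_ne hu, map_zero]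
    · simp
  have hblock : ∀ s t p, diffOp n (fun j => F j s t) p =
      (if s = t then E s p else 0) + A s t • (E t (X * p) - X * E s p) := by
    intro s t p
    rw [← hsingle, apply_single_eq hA hdiag]
  have hdeg : ∀ (s t : Fin N) (k : ℕ) (p : ℂ[X]), p.degree < k →
      (diffOp n (fun j => F j s t) p).degree < k := by
    intro s t k p hp
    rw [← hsingle]
    refine mem_rowDegreeLT.1 (matOp_mem_rowDegreeLT hP heig (mem_rowDegreeLT.2 fun u => ?_)) t
    by_cases hu : u = s
    · subst hu; rwa [Pi.single_eq_same]
    · rw [Pi.single_eq_of_ne hu, degree_zero]; exact WithBot.bot_lt_coe k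
  have hEd : ∀ s, E s = diffOp n fun j => F j s s := by
    refine fun s => LinearMap.ext fun p => ?_
    rw [hblock, if_pos rfl, hss, zero_smul, add_zero]
  choose f hf using fun s => exists_eval_eq_coeff_diffOp n fun j => F j s s
  have htri : ∀ s, IsTriangular (E s) fun k => (f s).eval (-2 * (k : ℂ)) := by
    intro s
    have h1 := isTriangular_of_degree_lt (E := E s) (by rw [hEd]; exact hdeg s s)
    have h2 : (fun k : ℕ => (f s).eval (-2 * (k : ℂ))) = fun k : ℕ => (E s (X ^ k)).coeff k := by
      funext k
      rw [hf, hEd]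
    rwa [h2]
  have hEf : ∀ s, E s = aeval (hermiteOp (β s)) (f s) := fun s =>
    (hL s).eq_aeval_hermiteOp (htri s) (hasTriangularAdjoint_shearConj hL hA hdiag hadj s)
  have hstep : ∀ s t, A s t ≠ 0 → f s = (f t).comp (X - C 2) := by
    intro s t hst
    have hne : s ≠ t := by
      rintro rfl
      exact hst (hss s)
    refine eq_of_infinite_eval_eq _ _ (Set.Infinite.mono (s := Set.range fun k : ℕ => -2 * (k : ℂ))
      ?_ (Set.infinite_range_of_injective fun k l h => by simpa using h))
    rintro _ ⟨k, rfl⟩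
    have hXk : (X ^ k : ℂ[X]).degree < (k + 1 : ℕ) := by
      rw [degree_X_pow]; exact_mod_cast Nat.lt_succ_self k
    have hXk' : (X ^ (k + 1) : ℂ[X]).degree < (k + 1 + 1 : ℕ) := by
      rw [degree_X_pow]; exact_mod_cast Nat.lt_succ_self (k + 1)
    have h1 := (degree_lt_iff_coeff_zero _ _).1 (hdeg s t (k + 1) _ hXk) (k + 1) le_rfl
    rw [hblock, if_neg hne, zero_add, coeff_smul, smul_eq_mul, coeff_sub, coeff_X_mul,
      ← pow_succ', (htri t (k + 1) _ hXk').2, (htri s k _ hXk).2, coeff_X_pow_self,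
      coeff_X_pow_self, mul_one, mul_one] at h1
    have h2 := sub_eq_zero.1 ((mul_eq_zero.1 h1).resolve_left hst)
    rw [Set.mem_ofPred_eq, eval_comp]
    refine h2.symm.trans ?_
    rw [eval_sub, eval_X, eval_C]
    push_cast
    rw [show -2 * ((k : ℂ) + 1) = -2 * k - 2 by ring]
  have hpair : ∀ s t, A s t ≠ 0 →
      (f s).natDegree = (f t).natDegree ∧ (f s).leadingCoeff = (f t).leadingCoeff := by
    intro s t hst
    rw [hstep s t hst, natDegree_comp, leadingCoeff_comp (by simp), natDegree_X_sub_C,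
      leadingCoeff_X_sub_C]
    simp
  have hconst : ∀ (k : ℕ) (hk : k < N), (f ⟨k, hk⟩).natDegree = (f ⟨0, hN⟩).natDegree ∧
      (f ⟨k, hk⟩).leadingCoeff = (f ⟨0, hN⟩).leadingCoeff := by
    intro k
    induction k with
    | zero => exact fun _ => ⟨rfl, rfl⟩
    | succ k ih =>
      intro hk
      obtain ⟨h1, h2⟩ := ih (by omega)
      rcases hcon ⟨k, by omega⟩ ⟨k + 1, hk⟩ rfl with h | h
      · obtain ⟨h3, h4⟩ := hpair _ _ h
        exact ⟨h3.symm.trans h1, h4.symm.trans h2⟩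
      · obtain ⟨h3, h4⟩ := hpair _ _ h
        exact ⟨h3.trans h1, h4.trans h2⟩
  set m := (f ⟨0, hN⟩).natDegree with hm
  set c := (f ⟨0, hN⟩).leadingCoeff with hc
  have hadE : ∀ s, (adX ^ (2 * m)) (E s) = (((2 * m).factorial : ℂ) * c) • 1 := by
    intro s
    obtain ⟨h1, h2⟩ := hconst s s.2
    have h3 := adX_pow_aeval_hermiteOp (β s) (f s)
    rwa [← hEf, h1, h2] at h3
  have hop : ∀ s t, diffOp n (fun j => F j s t) = (if s = t then E s else 0) +
      A s t • (E t * LinearMap.mulLeft ℂ X - LinearMap.mulLeft ℂ X * E s) := by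
    refine fun s t => LinearMap.ext fun p => ?_
    rw [hblock]
    split_ifs <;> rfl
  have had : ∀ s t, (adX ^ (2 * m)) (diffOp n fun j => F j s t) =
      if s = t then (((2 * m).factorial : ℂ) * c) • 1 else 0 := by
    intro s t
    rw [hop, map_add, map_smul, map_sub, adX_pow_mul_mulLeft, adX_pow_mulLeft_mul, hadE, hadE,
      smul_mul_assoc, mul_smul_comm, one_mul, mul_one, sub_self, smul_zero, add_zero]
    split_ifs
    · exact hadE s
    · exact map_zero _
  have hlead : ∀ s t p, (adX ^ n) (diffOp n fun j => F j s t) p =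
      (n.factorial : ℂ) • (F n s t * p) := by
    intro s t p
    rw [adX_pow_diffOp]
    rfl
  have hfac : ∀ k : ℕ, (k.factorial : ℂ) ≠ 0 := fun k => by exact_mod_cast k.factorial_ne_zero
  rcases lt_trichotomy n (2 * m) with h | h | h
  · exfalso
    have h1 := had ⟨0, hN⟩ ⟨0, hN⟩
    obtain ⟨i, hi⟩ : ∃ i, 2 * m = i + 1 + n := ⟨2 * m - n - 1, by omega⟩
    rw [if_pos rfl, hi, pow_add, Module.End.mul_apply, adX_pow_diffOp, map_smul, pow_succ,
      Module.End.mul_apply, adX_mulLeft, map_zero, smul_zero] at h1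
    have h2 := congrArg (fun G : Module.End ℂ ℂ[X] => (G 1).coeff 0) h1
    simp only [LinearMap.zero_apply, LinearMap.smul_apply, Module.End.one_apply, coeff_zero,
      coeff_smul, coeff_one_zero, smul_eq_mul, mul_one] at h2
    have h3 : c = 0 := (mul_eq_zero.1 h2.symm).resolve_left (hfac _)
    have h4 : m = 0 := by rw [hm, leadingCoeff_eq_zero.1 h3, natDegree_zero]
    omega
  · refine ⟨⟨m, by omega⟩, c, fun s t => ?_⟩
    have h1 := hlead s t 1
    have h2 := had s t
    rw [← h] at h2
    rw [h2, mul_one] at h1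
    refine smul_right_injective _ (hfac n) (h1.symm.trans ?_)
    split_ifs
    · simp [smul_eq_C_mul]
    · simp
  · exfalso
    refine hF (Matrix.ext fun s t => ?_)
    have h1 := hlead s t 1
    obtain ⟨i, hi⟩ : ∃ i, n = i + 1 + 2 * m := ⟨n - 2 * m - 1, by omega⟩
    have h2 : (adX ^ n) (diffOp n fun j => F j s t) = 0 := by
      conv_lhs => rw [show adX ^ n = adX ^ (i + 1) * adX ^ (2 * m) by rw [hi, pow_add]]
      rw [Module.End.mul_apply, had, pow_succ, Module.End.mul_apply]
      split_ifs
      · rw [map_smul, adX_one, smul_zero, map_zero]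
      · rw [map_zero, map_zero]
    rw [h2, mul_one] at h1
    exact (smul_eq_zero.1 h1.symm).resolve_left (hfac n)

end MatrixOperators

lemma integrable_eval_mul_exp (b : ℝ) (p : ℂ[X]) :
    Integrable fun x : ℝ => p.eval (x : ℂ) * (Real.exp (-x ^ 2 + 2 * b * x) : ℂ) := by
  have h0 : ∀ q : ℂ[X], Integrable fun x : ℝ => q.eval (x : ℂ) * (Real.exp (-x ^ 2) : ℂ) := by
    intro q
    induction q using Polynomial.induction_on' with
    | add p q hp hq =>
      refine (hp.add hq).congr (Filter.Eventually.of_forall fun x => ?_)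
      simp [add_mul]
    | monomial n c =>
      have h1 := integrable_rpow_mul_exp_neg_mul_sq (b := 1) one_pos (s := n)
        (lt_of_lt_of_le (by norm_num) (Nat.cast_nonneg n))
      refine (h1.ofReal (𝕜 := ℂ)).const_mul c |>.congr (Filter.Eventually.of_forall fun x => ?_)
      simp [eval_monomial, mul_assoc]
  have h1 := ((h0 (p.comp (X + C (b : ℂ)))).comp_sub_right b).mul_const (Real.exp (b ^ 2) : ℂ)
  refine h1.congr (Filter.Eventually.of_forall fun x => ?_)
  have h2 : Real.exp (-x ^ 2 + 2 * b * x) = Real.exp (-(x - b) ^ 2) * Real.exp (b ^ 2) := by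
    rw [← Real.exp_add]; congr 1; ring
  simp only [eval_comp, eval_add, eval_X, eval_C, h2]
  push_cast
  rw [sub_add_cancel, mul_assoc]

/-- Integration against `e^{-x²+2bx}`. -/
def hermiteFunctional (b : ℝ) : ℂ[X] →ₗ[ℂ] ℂ where
  toFun p := ∫ x : ℝ, p.eval (x : ℂ) * (Real.exp (-x ^ 2 + 2 * b * x) : ℂ)
  map_add' p q := by
    simp only [eval_add, add_mul]
    exact integral_add (integrable_eval_mul_exp b p) (integrable_eval_mul_exp b q)
  map_smul' c p := by
    simp only [eval_smul, smul_eq_mul, mul_assoc, RingHom.id_apply]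
    exact integral_const_mul _ _

lemma hermiteFunctional_apply (b : ℝ) (p : ℂ[X]) : hermiteFunctional b p =
    ∫ x : ℝ, p.eval (x : ℂ) * (Real.exp (-x ^ 2 + 2 * b * x) : ℂ) := rfl

lemma isHermiteFunctional_hermiteFunctional (b : ℝ) :
    IsHermiteFunctional (b : ℂ) (hermiteFunctional b) where
  deriv p := by
    have key : hermiteFunctional b (derivative p - (2 : ℂ) • ((X - C (b : ℂ)) * p)) = 0 := by
      rw [hermiteFunctional_apply]
      refine integral_eq_zero_of_hasDerivAt_of_integrable
        (f := fun x : ℝ => p.eval (x : ℂ) * (Real.exp (-x ^ 2 + 2 * b * x) : ℂ)) (fun x => ?_)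
        (integrable_eval_mul_exp b _) (integrable_eval_mul_exp b p)
      have h1 : HasDerivAt (fun x : ℝ => p.eval (x : ℂ)) ((derivative p).eval (x : ℂ)) x :=
        (p.hasDerivAt (x : ℂ)).comp_ofReal
      have h2 : HasDerivAt (fun x : ℝ => -x ^ 2 + 2 * b * x) (-(2 * x) + 2 * b) x := by
        refine (((hasDerivAt_pow 2 x).neg).add
          ((hasDerivAt_id x).const_mul (2 * b))).congr_deriv ?_
        simp
      have h3 := h1.mul (h2.exp.ofReal_comp)
      refine h3.congr_deriv ?_
      simp only [eval_sub, eval_smul, eval_mul, eval_X, eval_C, smul_eq_mul]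
      push_cast
      ring
    rw [map_sub, map_smul, smul_eq_mul, sub_eq_zero] at key
    exact key
  one_ne_zero := by
    have h0 : Integrable fun x : ℝ => Real.exp (-x ^ 2 + 2 * b * x) := by
      have h := (integrable_eval_mul_exp b 1).re
      refine h.congr (Filter.Eventually.of_forall fun x => ?_)
      simp only [eval_one, one_mul]
      exact Complex.ofReal_re _
    have h1 := integral_exp_pos h0
    rw [hermiteFunctional_apply]
    simp only [eval_one, one_mul]
    rw [integral_complex_ofReal]
    exact_mod_cast h1.ne'

lemma Amat_apply (N : ℕ) (a : ℕ → ℝ) (s t : Fin N) : Amat N a s t =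
    ((if ((t : ℕ) + 1) % 2 = 0 ∧ (s : ℕ) + 1 = t then a (s + 1) else
      if ((t : ℕ) + 1) % 2 = 0 ∧ (s : ℕ) = t + 1 then a (t + 1) else 0 : ℝ) : ℂ) := by
  have hs := s.2
  have ht := t.2
  simp only [Amat, EU, Matrix.add_apply, Matrix.sum_apply, Matrix.smul_apply, Matrix.of_apply,
    smul_eq_mul, mul_ite, mul_one, mul_zero]
  split_ifs with h1 h2
  · rw [Finset.sum_eq_single (((t : ℕ) + 1) / 2), if_pos (by omega), Finset.sum_eq_zero, add_zero]
    · congr 2; omega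
    · intro j hj
      rw [if_neg (by omega)]
    · intro j hj hne
      rw [if_neg (by omega)]
    · intro h
      exact absurd (Finset.mem_Icc.2 (by omega)) h
  · rw [Finset.sum_eq_zero, zero_add, Finset.sum_eq_single (((t : ℕ) + 1) / 2), if_pos (by omega)]
    · congr 2; omega
    · intro j hj hne
      rw [if_neg (by omega)]
    · intro h
      exact absurd (Finset.mem_Icc.2 (by omega)) h
    · intro j hj
      have := Finset.mem_Icc.1 hj
      rw [if_neg (by omega)]
  · rw [Finset.sum_eq_zero, Finset.sum_eq_zero]
    · simp
    · intro j hj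
      rw [if_neg (by omega)]
    · intro j hj
      have := Finset.mem_Icc.1 hj
      rw [if_neg (by omega)]

lemma Amat_mul_eq_zero (N : ℕ) (a : ℕ → ℝ) (s t u : Fin N) : Amat N a s t * Amat N a t u = 0 := by
  rw [Amat_apply, Amat_apply]
  split_ifs <;> first | omega | simp

lemma star_Amat_apply (N : ℕ) (a : ℕ → ℝ) (s t : Fin N) :
    star (Amat N a s t) = Amat N a s t := by
  rw [Amat_apply]
  exact Complex.conj_ofReal _

section MatrixEvaluation

variable {N : ℕ}

lemma mval_apply (Q : (Mat N)[X]) (x : ℝ) (s t : Fin N) :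
    mval Q x s t = (matPolyEquiv.symm Q s t).eval (x : ℂ) := by
  rw [← matPolyEquiv_eval, AlgEquiv.apply_symm_apply, mval, smul_one_eq_diagonal]
  rfl

lemma eval_vecMul_shear (a : ℕ → ℝ) (p : Fin N → ℂ[X]) (x : ℝ) (i : Fin N) :
    ((p ᵥ* shear (Amat N a)) i).eval (x : ℂ) =
      ((fun u => (p u).eval (x : ℂ)) ᵥ* Tmat N a x) i := by
  rw [vecMul_shear_apply, Tmat, vecMul_add, vecMul_one, vecMul_smul, Pi.add_apply, Pi.smul_apply]
  simp [eval_finsetSum, vecMul, dotProduct]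

lemma star_vecMul_Tmat (a : ℕ → ℝ) (v : Fin N → ℂ) (x : ℝ) :
    star (v ᵥ* Tmat N a x) = star v ᵥ* Tmat N a x := by
  funext i
  simp only [Pi.star_apply, vecMul, dotProduct, star_sum, star_mul']
  refine Finset.sum_congr rfl fun u _ => ?_
  congr 1
  simp only [Tmat, Matrix.add_apply, Matrix.smul_apply, star_add, star_smul, star_Amat_apply,
    Matrix.one_apply]
  congr 1
  · split_ifs <;> simp
  · simp

lemma shearForm_hermiteFunctional (a b : ℕ → ℝ) (P R : (Mat N)[X]) (s t : Fin N) :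
    shearForm (fun i : Fin N => hermiteFunctional (b (i + 1))) (Amat N a)
      (matPolyEquiv.symm P s)
      (fun u => (matPolyEquiv.symm R t u).map (starRingEnd ℂ)) =
      ∫ x : ℝ, (mval P x * WH N a b x * (mval R x)ᴴ) s t := by
  rw [shearForm_apply]
  simp only [hermiteFunctional_apply]
  rw [← integral_finsetSum _ fun i _ => integrable_eval_mul_exp _ _]
  congr 1
  funext x
  have h1 : mval P x * WH N a b x * (mval R x)ᴴ =
      mval P x * Tmat N a x * hermiteDiag N b x * (mval R x * Tmat N a x)ᴴ := by
    rw [WH, conjTranspose_mul]; simp only [Matrix.mul_assoc]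
  have h2 : ∀ u, (fun v => ((matPolyEquiv.symm R t v).map (starRingEnd ℂ)).eval (x : ℂ)) u =
      star (mval R x t) u := by
    intro u
    rw [Pi.star_apply, mval_apply]
    have h3 := Polynomial.eval_map_apply (p := matPolyEquiv.symm R t u) (starRingEnd ℂ) (x : ℂ)
    rw [Complex.conj_ofReal] at h3
    exact h3
  rw [h1, Matrix.mul_apply]
  refine Finset.sum_congr rfl fun i _ => ?_
  rw [eval_mul, eval_vecMul_shear, eval_vecMul_shear, funext h2, ← star_vecMul_Tmat, hermiteDiag,
    mul_diagonal, conjTranspose_apply, Matrix.mul_apply_eq_vecMul, Matrix.mul_apply_eq_vecMul,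
    Pi.star_apply, show (fun u => (matPolyEquiv.symm P s u).eval (x : ℂ)) = mval P x s from
      funext fun u => (mval_apply P x s u).symm]
  ring

lemma matPolyEquiv_symm_iterate_derivative (Q : (Mat N)[X]) (j : ℕ) (s t : Fin N) :
    matPolyEquiv.symm ((fun R : (Mat N)[X] => derivative R)^[j] Q) s t =
      derivative^[j] (matPolyEquiv.symm Q s t) := by
  induction j with
  | zero => rfl
  | succ j ih =>
    rw [Function.iterate_succ_apply', Function.iterate_succ_apply', ← ih]
    ext k
    rw [matPolyEquiv_symm_apply_coeff, coeff_derivative, coeff_derivative,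
      matPolyEquiv_symm_apply_coeff, ← Nat.cast_succ, ← nsmul_eq_mul', ← Nat.cast_succ,
      ← nsmul_eq_mul', Matrix.smul_apply]

lemma matOp_symm (n : ℕ) (F : ℕ → (Mat N)[X]) (Q : (Mat N)[X]) (s : Fin N) :
    matOp n (fun j => matPolyEquiv.symm (F j)) (matPolyEquiv.symm Q s) =
      matPolyEquiv.symm (applyOp F n Q) s := by
  funext t
  simp only [matOp_apply, diffOp_apply, applyOp, map_sum, map_mul]
  rw [Matrix.sum_apply, Finset.sum_comm]
  refine Finset.sum_congr rfl fun j _ => ?_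
  rw [Matrix.mul_apply]
  exact Finset.sum_congr rfl fun u _ => by rw [matPolyEquiv_symm_iterate_derivative]

end MatrixEvaluation

/-- any differential operator (of order `n`, with nonzero leading coefficient
`F_n`) having the monic orthogonal polynomials of `W_H` as eigenfunctions has even order and
its leading coefficient is a constant scalar matrix `cI`. -/
theorem stmt8 (N : ℕ) (hN : 2 ≤ N) (a : ℕ → ℝ)
    (ha : ∀ j, 1 ≤ j → j ≤ N - 1 → a j ≠ 0)
    (b : ℕ → ℝ)
    (hb : ∀ i j, 1 ≤ i → i ≤ N → 1 ≤ j → j ≤ N → i ≠ j → b i ≠ b j)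
    (P : ℕ → Polynomial (Mat N))
    (hdeg : ∀ n, (P n).natDegree = n)
    (hmonic : ∀ n, (P n).Monic)
    (horth : ∀ n m, n ≠ m → ∀ s t : Fin N,
      ∫ x : ℝ, (mval (P n) x * WH N a b x * (mval (P m) x)ᴴ) s t = 0)
    (n : ℕ) (F : ℕ → Polynomial (Mat N)) (hFn : F n ≠ 0)
    (heig : ∀ k : ℕ, ∃ Λ : Mat N, applyOp F n (P k) = Polynomial.C Λ * P k) :
    Even n ∧ ∃ c : ℂ, F n = Polynomial.C (c • (1 : Mat N)) := by
  have hco : ∀ k s t m, (matPolyEquiv.symm (P k) s t).coeff m = (P k).coeff m s t :=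
    fun k s t m => matPolyEquiv_symm_apply_coeff _ _ _ _
  have hP : IsMonicFamily fun k => matPolyEquiv.symm (P k) := by
    refine fun k s t => ⟨(degree_lt_iff_coeff_zero _ _).2 fun m hm => ?_, ?_⟩
    · rw [hco, coeff_eq_zero_of_natDegree_lt (by rw [hdeg]; omega), Matrix.zero_apply]
    · have h := hmonic k
      rw [Monic, leadingCoeff, hdeg] at h
      rw [hco, h]
  have hQ : IsMonicFamily fun k => Matrix.of fun s t =>
      (matPolyEquiv.symm (P k) s t).map (starRingEnd ℂ) := by
    refine fun k s t => ⟨lt_of_le_of_lt degree_map_le (hP k s t).1, ?_⟩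
    change ((matPolyEquiv.symm (P k) s t).map (starRingEnd ℂ)).coeff k = _
    rw [coeff_map, (hP k s t).2, Matrix.one_apply]
    split_ifs <;> simp
  choose Λ hΛ using heig
  have hmain := even_and_leading_scalar (n := n) (A := Amat N a)
    (β := fun i : Fin N => ((b (i + 1) : ℝ) : ℂ))
    (F := fun j => matPolyEquiv.symm (F j)) (Λ := Λ) (by omega)
    (fun i => isHermiteFunctional_hermiteFunctional (b (i + 1))) (fun i j hij => ?_)
    (Amat_mul_eq_zero N a) (fun i j hij => ?_) hP hQ (fun k m hkm s t => ?_) (fun k s => ?_)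
    (fun h => hFn (matPolyEquiv.symm.map_eq_zero_iff.1 h))
  · obtain ⟨hn, c, hc⟩ := hmain
    refine ⟨hn, c, matPolyEquiv.symm.injective (Matrix.ext fun s t => ?_)⟩
    rw [hc]
    ext k
    rw [matPolyEquiv_symm_apply_coeff, coeff_C]
    split_ifs with h1 h2 h2 <;> simp [coeff_C, h1, h2]
  · by_contra hne
    have hne' : (i : ℕ) + 1 ≠ j + 1 := fun h => hne (Fin.ext (by omega))
    exact hb _ _ (by omega) i.2 (by omega) j.2 hne' (Complex.ofReal_injective hij)
  · have hj := j.2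
    have h1 := ha (i + 1) (by omega) (by omega)
    rw [Amat_apply, Amat_apply, Complex.ofReal_ne_zero, Complex.ofReal_ne_zero]
    rcases Nat.mod_two_eq_zero_or_one ((j : ℕ) + 1) with h | h
    · left
      rwa [if_pos ⟨h, hij⟩]
    · right
      rwa [if_neg (by omega), if_pos ⟨by omega, hij.symm⟩]
  · exact (shearForm_hermiteFunctional a b (P k) (P m) s t).trans (horth k m hkm s t)
  · rw [matOp_symm, hΛ, map_mul, matPolyEquiv_symm_C]
    funext t
    rw [Matrix.mul_apply, Finset.sum_apply]
    exact Finset.sum_congr rfl fun u _ => by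
      rw [Pi.smul_apply, smul_eq_C_mul, Matrix.map_apply]
end
end
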